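/- Suppose k = k(n) ≥ 3 and r = r(n) ≥ 2 satisfy r = o(√(ln ln k)) and (3/16) · e^{−4r²} · (k/ln k)^{⌊log₂ r⌋/(⌊log₂ r⌋+1)} · r^k/k − ln n → −∞ as n → ∞. If p = p(n) ≤ (3/16) · e^{−4r²} · (k/ln k)^{⌊log₂ r⌋/(⌊log₂ r⌋+1)} · (r^k/k²) · n/C(n,k), then P(H(n,k,p) is r-colorable) → 1 as n → ∞. -/

import Mathlib

open Finset Filter

open scoped Classical

namespace HG

/-- A finset `e` is monochromatic under the coloring `c`. -/
def Monochromatic {V α : Type*} (c : V → α) (e : Finset V) : Prop :=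
  ∀ v ∈ e, ∀ w ∈ e, c v = c w

/-- The hypergraph with edge set `E` admits a proper coloring with `r` colors. -/
def RColorable {V : Type*} (r : ℕ) (E : Finset (Finset V)) : Prop :=
  ∃ c : V → Fin r, ∀ e ∈ E, ¬ Monochromatic c e

/-- The hypergraph with edge set `E` is `r`-choosable: for every assignment of
color lists of size `r` there is a proper coloring from the lists. -/
def RChoosable {V : Type*} (r : ℕ) (E : Finset (Finset V)) : Prop :=
  ∀ L : V → Finset ℕ, (∀ v, (L v).card = r) →
    ∃ c : V → ℕ, (∀ v, c v ∈ L v) ∧ ∀ e ∈ E, ¬ Monochromatic c e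

/-- Probability that the binomial random hypergraph `H(n,k,p)` (each of the
`C(n,k)` possible `k`-element edges present independently with probability `p`)
satisfies the property `P` of its edge set. -/
noncomputable def hyperProb (n k : ℕ) (p : ℝ)
    (P : Finset (Finset (Fin n)) → Prop) : ℝ :=
  ∑ E ∈ ((Finset.univ : Finset (Fin n)).powersetCard k).powerset,
    if P E then
      p ^ E.card *
        (1 - p) ^ (((Finset.univ : Finset (Fin n)).powersetCard k).card - E.card)
    else 0

/-- Maximum vertex degree of the hypergraph with edge set `E`. -/
def maxDegree {V : Type*} [DecidableEq V] (E : Finset (Finset V)) : ℕ :=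
  (E.biUnion id).sup fun v => (E.filter fun e => v ∈ e).card

/-- Three distinct edges forming a 3-cycle (triangle). -/
def IsTriangle {V : Type*} [DecidableEq V] (e f h : Finset V) : Prop :=
  e ≠ f ∧ e ≠ h ∧ f ≠ h ∧ ((e ∩ f) \ h).Nonempty ∧ ((e ∩ h) \ f).Nonempty ∧
    ((f ∩ h) \ e).Nonempty

/-- A hypergraph is 2-simple if any two distinct edges share at most 2 vertices. -/
def TwoSimple {V : Type*} [DecidableEq V] (E : Finset (Finset V)) : Prop :=
  ∀ e ∈ E, ∀ f ∈ E, e ≠ f → (e ∩ f).card ≤ 2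

/-- The number of 3-cycles of the hypergraph `E` containing the edge `e`. -/
noncomputable def triCount {V : Type*} [DecidableEq V]
    (E : Finset (Finset V)) (e : Finset V) : ℕ :=
  ((E.powersetCard 2).filter fun s =>
    ∃ f ∈ s, ∃ h ∈ s, f ≠ h ∧ IsTriangle e f h).card

/-- The function `φ(k) = 4⌊√(ln k / ln (2 ln k))⌋⁻¹`. -/
noncomputable def phi (k : ℕ) : ℝ :=
  4 * ((⌊Real.sqrt (Real.log k / Real.log (2 * Real.log k))⌋₊ : ℝ))⁻¹

end HG

/-- The exponent `⌊log₂ r⌋ / (⌊log₂ r⌋ + 1)`. -/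
noncomputable def logExp (r : ℕ) : ℝ :=
  (⌊Real.logb 2 (r : ℝ)⌋₊ : ℝ) / ((⌊Real.logb 2 (r : ℝ)⌋₊ : ℝ) + 1)

namespace HG

/-- The weight of `E` in the random subset of `Ω` with density `p`. -/
noncomputable def subsetWeight {α : Type*} (p : ℝ) (Ω E : Finset α) : ℝ :=
  p ^ E.card * (1 - p) ^ (Ω.card - E.card)

/-- The probability that the random subset of `Ω` with density `p` satisfies `P`. -/
noncomputable def subsetProb {α : Type*} (p : ℝ) (Ω : Finset α) (P : Finset α → Prop) : ℝ :=
  ∑ E ∈ Ω.powerset, if P E then subsetWeight p Ω E else 0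

section SubsetProb

variable {α : Type*} {p : ℝ}

lemma subsetWeight_nonneg (hp0 : 0 ≤ p) (hp1 : p ≤ 1) (Ω E : Finset α) :
    0 ≤ subsetWeight p Ω E :=
  mul_nonneg (pow_nonneg hp0 _) (pow_nonneg (by linarith) _)

lemma sum_subsetWeight (Ω : Finset α) : ∑ E ∈ Ω.powerset, subsetWeight p Ω E = 1 := by
  simp [subsetWeight, Finset.sum_pow_mul_eq_add_pow]

lemma subsetProb_add_not (Ω : Finset α) (P : Finset α → Prop) :
    subsetProb p Ω P + subsetProb p Ω (fun E => ¬ P E) = 1 := by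
  rw [← sum_subsetWeight (p := p) Ω, subsetProb, subsetProb, ← Finset.sum_add_distrib]
  refine Finset.sum_congr rfl fun E _ => ?_
  by_cases h : P E <;> simp [h]

lemma subsetProb_nonneg (hp0 : 0 ≤ p) (hp1 : p ≤ 1) (Ω : Finset α) (P : Finset α → Prop) :
    0 ≤ subsetProb p Ω P := by
  refine Finset.sum_nonneg fun E _ => ?_
  split_ifs
  exacts [subsetWeight_nonneg hp0 hp1 _ _, le_rfl]

lemma subsetProb_le_one (hp0 : 0 ≤ p) (hp1 : p ≤ 1) (Ω : Finset α) (P : Finset α → Prop) :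
    subsetProb p Ω P ≤ 1 := by
  have := subsetProb_add_not (p := p) Ω P
  have := subsetProb_nonneg hp0 hp1 Ω (fun E => ¬ P E)
  linarith

lemma subsetProb_mono (hp0 : 0 ≤ p) (hp1 : p ≤ 1) {Ω : Finset α} {P Q : Finset α → Prop}
    (h : ∀ E ⊆ Ω, P E → Q E) : subsetProb p Ω P ≤ subsetProb p Ω Q := by
  refine Finset.sum_le_sum fun E hE => ?_
  have hw := subsetWeight_nonneg hp0 hp1 Ω E
  by_cases hP : P E
  · simp [hP, h E (Finset.mem_powerset.1 hE) hP]
  · rw [if_neg hP]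
    split_ifs <;> simp [hw]

lemma subsetProb_or_le (hp0 : 0 ≤ p) (hp1 : p ≤ 1) (Ω : Finset α) (P Q : Finset α → Prop) :
    subsetProb p Ω (fun E => P E ∨ Q E) ≤ subsetProb p Ω P + subsetProb p Ω Q := by
  rw [subsetProb, subsetProb, subsetProb, ← Finset.sum_add_distrib]
  refine Finset.sum_le_sum fun E _ => ?_
  have hw := subsetWeight_nonneg hp0 hp1 Ω E
  by_cases hP : P E <;> by_cases hQ : Q E <;> simp [hP, hQ, hw]

lemma subsetProb_exists_le {ι : Type*} (hp0 : 0 ≤ p) (hp1 : p ≤ 1) (Ω : Finset α)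
    (s : Finset ι) (P : ι → Finset α → Prop) :
    subsetProb p Ω (fun E => ∃ i ∈ s, P i E) ≤ ∑ i ∈ s, subsetProb p Ω (P i) := by
  simp only [subsetProb]
  rw [Finset.sum_comm]
  refine Finset.sum_le_sum fun E _ => ?_
  have hw := subsetWeight_nonneg hp0 hp1 Ω E
  have hn : ∀ i ∈ s, 0 ≤ if P i E then subsetWeight p Ω E else 0 := fun i _ => by
    split_ifs <;> simp [hw]
  split_ifs with h
  · obtain ⟨i, hi, hP⟩ := h
    refine le_trans ?_ (Finset.single_le_sum hn hi)
    simp [hP]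
  · exact Finset.sum_nonneg hn

lemma sum_powerset_union {M : Type*} [AddCommMonoid M] {X Y : Finset α} (h : Disjoint X Y)
    (f : Finset α → M) :
    ∑ E ∈ (X ∪ Y).powerset, f E = ∑ A ∈ X.powerset, ∑ B ∈ Y.powerset, f (A ∪ B) := by
  rw [← Finset.sum_product']
  refine Finset.sum_bij' (fun E _ => (E ∩ X, E ∩ Y)) (fun q _ => q.1 ∪ q.2) ?_ ?_ ?_ ?_ ?_
  · intro E _
    simp [Finset.inter_subset_right]
  · rintro ⟨A, B⟩ hq
    simp only [Finset.mem_product, Finset.mem_powerset] at hq ⊢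
    exact Finset.union_subset_union hq.1 hq.2
  · intro E hE
    rw [Finset.mem_powerset] at hE
    simp only
    rw [← Finset.inter_union_distrib_left]
    exact Finset.inter_eq_left.2 hE
  · rintro ⟨A, B⟩ hq
    simp only [Finset.mem_product, Finset.mem_powerset] at hq
    have h1 : Disjoint B X := (h.mono_right hq.2).symm
    have h2 : Disjoint A Y := h.mono_left hq.1
    simp only [Finset.union_inter_distrib_right, Finset.inter_eq_left.2 hq.1,
      Finset.inter_eq_left.2 hq.2, Finset.disjoint_iff_inter_eq_empty.1 h1,
      Finset.disjoint_iff_inter_eq_empty.1 h2, Finset.union_empty, Finset.empty_union]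
  · intro E hE
    rw [Finset.mem_powerset] at hE
    simp only
    rw [← Finset.inter_union_distrib_left, Finset.inter_eq_left.2 hE]

lemma subsetProb_union {X Y : Finset α} (h : Disjoint X Y) (P : Finset α → Prop) :
    subsetProb p (X ∪ Y) P =
      ∑ A ∈ X.powerset, subsetWeight p X A * subsetProb p Y (fun B => P (A ∪ B)) := by
  rw [subsetProb, sum_powerset_union h]
  refine Finset.sum_congr rfl fun A hA => ?_
  rw [subsetProb, Finset.mul_sum]
  refine Finset.sum_congr rfl fun B hB => ?_
  rw [Finset.mem_powerset] at hA hB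
  have h1 : (A ∪ B).card = A.card + B.card :=
    Finset.card_union_of_disjoint ((h.mono_left hA).mono_right hB)
  have h2 : (X ∪ Y).card - (A ∪ B).card = (X.card - A.card) + (Y.card - B.card) := by
    rw [h1, Finset.card_union_of_disjoint h]
    have := Finset.card_le_card hA
    have := Finset.card_le_card hB
    omega
  split_ifs
  · rw [subsetWeight, subsetWeight, subsetWeight, h2, h1]
    ring
  · simp

lemma subsetProb_superset {Ω X : Finset α} (hX : X ⊆ Ω) :
    subsetProb p Ω (fun E => X ⊆ E) = p ^ X.card := by
  have h : Disjoint (Ω \ X) X := Finset.sdiff_disjoint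
  conv_lhs => rw [← Finset.sdiff_union_of_subset hX]
  rw [subsetProb_union h]
  have key : ∀ A ∈ (Ω \ X).powerset, subsetProb p X (fun B => X ⊆ A ∪ B) = p ^ X.card := by
    intro A hA
    rw [Finset.mem_powerset] at hA
    rw [subsetProb, Finset.sum_eq_single X]
    · simp [subsetWeight]
    · intro B hB hne
      rw [Finset.mem_powerset] at hB
      rw [if_neg]
      intro hsub
      refine hne (Finset.Subset.antisymm hB fun x hx => ?_)
      rcases Finset.mem_union.1 (hsub hx) with h' | h'
      · exact absurd hx (Finset.mem_sdiff.1 (hA h')).2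
      · exact h'
    · intro h'
      simp at h'
  rw [Finset.sum_congr rfl fun A hA => by rw [key A hA], ← Finset.sum_mul, sum_subsetWeight,
    one_mul]

lemma mul_subsetProb_card_le (hp0 : 0 ≤ p) (hp1 : p ≤ 1) {Ω G : Finset α} (hG : G ⊆ Ω)
    (t : ℝ) :
    t * subsetProb p Ω (fun E => t ≤ ((E ∩ G).card : ℝ)) ≤ p * G.card := by
  have h1 : ∑ e ∈ G, subsetProb p Ω (fun E => {e} ⊆ E) = p * G.card := by
    rw [Finset.sum_congr rfl fun e he =>
      subsetProb_superset (p := p) (Finset.singleton_subset_iff.2 (hG he))]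
    simp [mul_comm]
  rw [← h1]
  simp only [subsetProb]
  rw [Finset.sum_comm, Finset.mul_sum]
  refine Finset.sum_le_sum fun E _ => ?_
  have hw := subsetWeight_nonneg hp0 hp1 Ω E
  have h2 : (∑ e ∈ G, if {e} ⊆ E then subsetWeight p Ω E else 0)
      = (E ∩ G).card * subsetWeight p Ω E := by
    rw [← Finset.sum_filter, Finset.sum_const, nsmul_eq_mul]
    congr 3
    ext e
    simp [and_comm]
  refine le_of_le_of_eq ?_ (h2.symm.trans (Finset.sum_congr rfl fun e _ => by congr))
  split_ifs with h
  · exact mul_le_mul_of_nonneg_right h hw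
  · simpa using mul_nonneg (Nat.cast_nonneg _) hw

/-- Revealing the levels of `Ω` one at a time: if, given that stage `i` succeeded, stage `i + 1`
fails with probability at most `δ i`, then all stages succeed with probability at least
`1 - ∑ δ i`. -/
lemma subsetProb_levels_not_le (hp0 : 0 ≤ p) (hp1 : p ≤ 1) (Ω : Finset α) (lev : α → ℕ)
    (A : ℕ → Finset α → Prop) (δ : ℕ → ℝ) (L : ℕ) (hδ : ∀ i, 0 ≤ δ i)
    (hA0 : A 0 ∅)
    (hstep : ∀ i < L, ∀ E ⊆ Ω.filter (fun e => lev e < i), A i E →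
      subsetProb p (Ω.filter fun e => lev e = i) (fun F => ¬ A (i + 1) (E ∪ F)) ≤ δ i) :
    subsetProb p (Ω.filter fun e => lev e < L) (fun E => ¬ A L E) ≤ ∑ i ∈ range L, δ i := by
  induction L with
  | zero => simp [subsetProb, hA0]
  | succ i ih =>
    have hdisj : Disjoint (Ω.filter fun e => lev e < i) (Ω.filter fun e => lev e = i) := by
      rw [Finset.disjoint_filter]
      intro e _ h
      omega
    have hun : (Ω.filter fun e => lev e < i + 1) =
        (Ω.filter fun e => lev e < i) ∪ (Ω.filter fun e => lev e = i) := by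
      rw [← Finset.filter_or]
      refine Finset.filter_congr fun e _ => ?_
      omega
    rw [hun, subsetProb_union hdisj, Finset.sum_range_succ]
    have ih' := ih fun j hj => hstep j (by omega)
    refine le_trans ?_ (add_le_add_left ih' (δ i))
    have h1 : δ i = ∑ E ∈ (Ω.filter fun e => lev e < i).powerset,
        subsetWeight p (Ω.filter fun e => lev e < i) E * δ i := by
      rw [← Finset.sum_mul, sum_subsetWeight, one_mul]
    rw [h1, subsetProb, ← Finset.sum_add_distrib]
    refine Finset.sum_le_sum fun E hE => ?_
    rw [Finset.mem_powerset] at hE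
    have hw := subsetWeight_nonneg hp0 hp1 (Ω.filter fun e => lev e < i) E
    by_cases hAE : A i E
    · rw [if_neg (not_not.2 hAE), zero_add]
      exact mul_le_mul_of_nonneg_left (hstep i (by omega) E hE hAE) hw
    · rw [if_pos hAE]
      have := mul_le_mul_of_nonneg_left (subsetProb_le_one hp0 hp1
        (Ω.filter fun e => lev e = i) (fun F => ¬ A (i + 1) (E ∪ F))) hw
      have := mul_nonneg hw (hδ i)
      linarith

end SubsetProb

section PairGraph

variable {V : Type*}

/-- The graph in which each `e ∈ F` contributes the edge joining `πx e` and `πy e`. -/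
def pairGraph (πx πy : Finset V → V) (F : Finset (Finset V)) : SimpleGraph V :=
  SimpleGraph.fromRel fun a b => ∃ e ∈ F, πx e = a ∧ πy e = b

lemma pairGraph_adj {πx πy : Finset V → V} {F : Finset (Finset V)} {a b : V} :
    (pairGraph πx πy F).Adj a b ↔ a ≠ b ∧ ∃ e ∈ F, s(πx e, πy e) = s(a, b) := by
  simp only [pairGraph, SimpleGraph.fromRel_adj, Sym2.eq_iff]
  refine and_congr_right fun _ => ⟨?_, ?_⟩
  · rintro (⟨e, he, h⟩ | ⟨e, he, h⟩)
    exacts [⟨e, he, Or.inl h⟩, ⟨e, he, Or.inr h⟩]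
  · rintro ⟨e, he, h | h⟩
    exacts [Or.inl ⟨e, he, h⟩, Or.inr ⟨e, he, h⟩]

/-- The cyclic successor of the `j`-th entry of `x`. -/
def cyclicNext {l : ℕ} (x : Fin l → V) (j : Fin l) : V :=
  if h : j.1 + 1 < l then x ⟨j.1 + 1, h⟩ else x ⟨0, j.pos⟩

lemma exists_cyclic_edges_of_not_isAcyclic {πx πy : Finset V → V} {F : Finset (Finset V)}
    (h : ¬ (pairGraph πx πy F).IsAcyclic) :
    ∃ l : ℕ, 1 ≤ l ∧ ∃ (x : Fin l → V) (e : Fin l → Finset V), Function.Injective e ∧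
      ∀ j, e j ∈ F ∧ s(πx (e j), πy (e j)) = s(x j, cyclicNext x j) := by
  simp only [SimpleGraph.IsAcyclic, not_forall, not_not] at h
  obtain ⟨v, c, hc⟩ := h
  have hadj : ∀ j : Fin c.length, ∃ e ∈ F,
      s(πx e, πy e) = s(c.getVert j, c.getVert (j + 1)) := fun j =>
    (pairGraph_adj.1 (c.adj_getVert_succ j.2)).2
  choose e he hs using hadj
  have hpos : 1 ≤ c.length := by
    have := hc.three_le_length
    omega
  refine ⟨c.length, hpos, fun j => c.getVert j, e, ?_, fun j => ⟨he j, ?_⟩⟩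
  · intro i j hij
    have hnd := hc.isTrail.edges_nodup
    have hi : i.1 < c.edges.length := by simp
    have hj : j.1 < c.edges.length := by simp
    have hE : ∀ (i : Fin c.length) (hi : i.1 < c.edges.length),
        c.edges[i.1] = s(πx (e i), πy (e i)) := by
      intro i hi
      rw [hs i, SimpleGraph.Walk.getElem_edges]
    have : c.edges[i.1] = c.edges[j.1] := by rw [hE i hi, hE j hj, hij]
    exact Fin.ext ((hnd.getElem_inj_iff).1 this)
  · rw [hs j]
    congr 2
    simp only [cyclicNext]
    split_ifs with hlt
    · rfl
    · have : j.1 + 1 = c.length := by have := j.2; omega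
      simp [this]

lemma subsetProb_not_isAcyclic_le {p : ℝ} (hp0 : 0 ≤ p) (hp1 : p ≤ 1)
    {πx πy : Finset V → V} {Ω G : Finset (Finset V)} (hG : G ⊆ Ω) {B : Finset V} {M lam : ℝ}
    (hM0 : 0 ≤ M) (hx : ∀ e ∈ G, πx e ∈ B) (hy : ∀ e ∈ G, πy e ∈ B)
    (hM : ∀ a b, ((G.filter fun e => s(πx e, πy e) = s(a, b)).card : ℝ) ≤ M)
    (hlam : p * B.card * M ≤ lam) (hlam2 : lam ≤ 1 / 2) :
    subsetProb p Ω (fun E => ¬ (pairGraph πx πy (E ∩ G)).IsAcyclic) ≤ 2 * lam := by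
  have hlam0 : 0 ≤ p * B.card * M := by positivity
  have hterm : ∀ l ∈ Finset.Icc 1 G.card,
      ∑ x ∈ Fintype.piFinset (fun _ : Fin l => B),
        ∑ e ∈ Fintype.piFinset
          (fun j => G.filter fun e => s(πx e, πy e) = s(x j, cyclicNext x j)),
          subsetProb p Ω (fun E => Function.Injective e ∧ Finset.univ.image e ⊆ E) ≤
      lam ^ l := by
    intro l _
    have h1 : ∀ x ∈ Fintype.piFinset (fun _ : Fin l => B),
        ∑ e ∈ Fintype.piFinset
          (fun j => G.filter fun e => s(πx e, πy e) = s(x j, cyclicNext x j)),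
          subsetProb p Ω (fun E => Function.Injective e ∧ Finset.univ.image e ⊆ E) ≤
        M ^ l * p ^ l := by
      intro x _
      have h2 : ∀ e ∈ Fintype.piFinset
          (fun j => G.filter fun e => s(πx e, πy e) = s(x j, cyclicNext x j)),
          subsetProb p Ω (fun E => Function.Injective e ∧ Finset.univ.image e ⊆ E) ≤
            p ^ l := by
        intro e he
        rw [Fintype.mem_piFinset] at he
        by_cases hinj : Function.Injective e
        · have hsub : Finset.univ.image e ⊆ Ω := by
            intro f hf
            obtain ⟨j, _, rfl⟩ := Finset.mem_image.1 hf
            exact hG (Finset.mem_filter.1 (he j)).1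
          have h3 := subsetProb_superset (p := p) hsub
          rw [Finset.card_image_of_injective _ hinj, Finset.card_univ, Fintype.card_fin] at h3
          rw [← h3]
          exact subsetProb_mono hp0 hp1 fun E _ h => h.2
        · simp only [subsetProb, hinj, false_and, if_false, Finset.sum_const_zero]
          positivity
      refine (Finset.sum_le_sum h2).trans ?_
      rw [Finset.sum_const, nsmul_eq_mul, Fintype.card_piFinset]
      refine mul_le_mul_of_nonneg_right ?_ (by positivity)
      push_cast
      refine (Finset.prod_le_prod (fun _ _ => by positivity) fun j _ => hM _ _).trans ?_
      simp
    refine (Finset.sum_le_sum h1).trans ?_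
    rw [Finset.sum_const, nsmul_eq_mul, Fintype.card_piFinset]
    simp only [Finset.prod_const, Finset.card_univ, Fintype.card_fin]
    push_cast
    calc (B.card : ℝ) ^ l * (M ^ l * p ^ l) = (p * B.card * M) ^ l := by
          rw [mul_pow, mul_pow]; ring
      _ ≤ lam ^ l := pow_le_pow_left₀ hlam0 hlam l
  have hevent : subsetProb p Ω (fun E => ¬ (pairGraph πx πy (E ∩ G)).IsAcyclic) ≤
      subsetProb p Ω (fun E => ∃ l ∈ Finset.Icc 1 G.card,
        ∃ x ∈ Fintype.piFinset (fun _ : Fin l => B),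
        ∃ e ∈ Fintype.piFinset
          (fun j => G.filter fun e => s(πx e, πy e) = s(x j, cyclicNext x j)),
          Function.Injective e ∧ Finset.univ.image e ⊆ E) := by
    refine subsetProb_mono hp0 hp1 fun E _ hE => ?_
    obtain ⟨l, hl, x, e, hinj, h⟩ := exists_cyclic_edges_of_not_isAcyclic hE
    have heG : ∀ j, e j ∈ G := fun j => (Finset.mem_inter.1 (h j).1).2
    refine ⟨l, Finset.mem_Icc.2 ⟨hl, ?_⟩, x, ?_, e, ?_, hinj, ?_⟩
    · have := Finset.card_le_card (show Finset.univ.image e ⊆ G by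
        intro f hf
        obtain ⟨j, _, rfl⟩ := Finset.mem_image.1 hf
        exact heG j)
      rwa [Finset.card_image_of_injective _ hinj, Finset.card_univ, Fintype.card_fin] at this
    · rw [Fintype.mem_piFinset]
      intro j
      have h1 := hx _ (heG j)
      have h2 := hy _ (heG j)
      rcases Sym2.eq_iff.1 (h j).2 with ⟨h3, _⟩ | ⟨_, h3⟩
      · rwa [← h3]
      · rwa [← h3]
    · rw [Fintype.mem_piFinset]
      exact fun j => Finset.mem_filter.2 ⟨heG j, (h j).2⟩
    · intro f hf
      obtain ⟨j, _, rfl⟩ := Finset.mem_image.1 hf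
      exact (Finset.mem_inter.1 (h j).1).1
  refine hevent.trans ((subsetProb_exists_le hp0 hp1 Ω _ _).trans ?_)
  have hl0 : 0 ≤ lam := hlam0.trans hlam
  calc _ ≤ ∑ l ∈ Finset.Icc 1 G.card, lam ^ l := by
        refine Finset.sum_le_sum fun l hl => ?_
        refine ((subsetProb_exists_le hp0 hp1 Ω _ _).trans ?_).trans (hterm l hl)
        exact Finset.sum_le_sum fun x _ => subsetProb_exists_le hp0 hp1 Ω _ _
    _ = lam * ∑ l ∈ Finset.range G.card, lam ^ l := by
        have hIcc : Finset.Icc 1 G.card = Finset.Ico 1 (G.card + 1) := by ext; simp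
        rw [hIcc, Finset.sum_Ico_eq_sum_range, Finset.mul_sum]
        exact Finset.sum_congr (by simp) fun l _ => by rw [pow_add, pow_one]
    _ ≤ lam * 2 := by
        refine mul_le_mul_of_nonneg_left ?_ hl0
        have := geom_sum_mul lam G.card
        have h2 : 0 ≤ lam ^ G.card := by positivity
        nlinarith
    _ = 2 * lam := by ring

end PairGraph

section ColoringExtension

variable {V : Type*}

/-- A partial coloring can be extended so that no color is used more than `m` times. -/
lemma exists_balanced_extension {r m : ℕ} {T : Finset V} (f : V → Fin r)
    (hT : T.card ≤ m) (X : Finset V) (hTX : Disjoint T X) (hX : (T ∪ X).card ≤ r * m) :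
    ∃ g : V → Fin r, (∀ v ∈ T, g v = f v) ∧
      ∀ a, ((T ∪ X).filter fun v => g v = a).card ≤ m := by
  induction X using Finset.induction_on with
  | empty =>
    exact ⟨f, fun _ _ => rfl, fun a =>
      (Finset.card_le_card (Finset.filter_subset _ _)).trans (by simpa using hT)⟩
  | insert v X hv ih =>
    rw [Finset.disjoint_insert_right] at hTX
    have hvn : v ∉ T ∪ X := by simp [hTX.1, hv]
    rw [Finset.union_insert, Finset.card_insert_of_notMem hvn] at hX
    obtain ⟨g, hg, hga⟩ := ih hTX.2 (by omega)
    obtain ⟨a₀, ha₀⟩ : ∃ a : Fin r, ((T ∪ X).filter fun v => g v = a).card < m := by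
      by_contra! hcon
      have h1 := Finset.card_eq_sum_card_fiberwise (f := g) (s := T ∪ X) (t := Finset.univ)
        (fun _ _ => by simp)
      have h2 : ∑ a : Fin r, m ≤ ∑ a : Fin r, ((T ∪ X).filter fun v => g v = a).card :=
        Finset.sum_le_sum fun a _ => hcon a
      simp at h2
      omega
    refine ⟨Function.update g v a₀, fun w hw => ?_, fun a => ?_⟩
    · rw [Function.update_of_ne (ne_of_mem_of_not_mem hw hTX.1)]
      exact hg w hw
    · have hcongr : ((T ∪ X).filter fun w => Function.update g v a₀ w = a) =
          (T ∪ X).filter fun w => g w = a := by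
        refine Finset.filter_congr fun w hw => ?_
        rw [Function.update_of_ne (ne_of_mem_of_not_mem hw hvn)]
      rw [Finset.union_insert, Finset.filter_insert, hcongr]
      split_ifs with h
      · have : a = a₀ := by simpa using h.symm
        subst this
        exact (Finset.card_insert_le _ _).trans ha₀
      · exact hga a

/-- If the pair graph of `F` is acyclic and `F` is small, the coloring `c` can be changed on `B`
so that it separates the chosen pair of each member of `F`, without overusing a color. -/
lemma exists_recoloring {r m : ℕ} (hr : 2 ≤ r) (c : V → Fin r) {B : Finset V}
    {πx πy : Finset V → V} {F : Finset (Finset V)} (hx : ∀ e ∈ F, πx e ∈ B)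
    (hy : ∀ e ∈ F, πy e ∈ B) (hne : ∀ e ∈ F, πx e ≠ πy e)
    (hacyc : (pairGraph πx πy F).IsAcyclic) (hF : 2 * F.card ≤ m) :
    ∃ g : V → Fin r, (∀ v ∉ B, g v = c v) ∧ (∀ e ∈ F, g (πx e) ≠ g (πy e)) ∧
      (B.card ≤ r * m → ∀ a, (B.filter fun v => g v = a).card ≤ m) := by
  obtain ⟨κ⟩ := hacyc.colorable_two
  set f : V → Fin r := fun v => Fin.castLE hr (κ v) with hf
  have hsep : ∀ e ∈ F, f (πx e) ≠ f (πy e) := by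
    intro e he h
    exact κ.valid (pairGraph_adj.2 ⟨hne e he, e, he, rfl⟩) (Fin.castLE_injective hr h)
  set T := F.image πx ∪ F.image πy with hTdef
  have hTc : T.card ≤ m := by
    refine (Finset.card_union_le _ _).trans ?_
    have h1 := Finset.card_image_le (s := F) (f := πx)
    have h2 := Finset.card_image_le (s := F) (f := πy)
    omega
  have hTB : T ⊆ B := by
    intro v hv
    rcases Finset.mem_union.1 hv with h | h <;> obtain ⟨e, he, rfl⟩ := Finset.mem_image.1 h
    exacts [hx e he, hy e he]
  obtain ⟨g, hg, hga⟩ : ∃ g : V → Fin r, (∀ v ∈ T, g v = f v) ∧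
      (B.card ≤ r * m → ∀ a, (B.filter fun v => g v = a).card ≤ m) := by
    by_cases hB : B.card ≤ r * m
    · obtain ⟨g, hg, hga⟩ := exists_balanced_extension f hTc (B \ T) Finset.disjoint_sdiff
        (by rwa [Finset.union_sdiff_of_subset hTB])
      rw [Finset.union_sdiff_of_subset hTB] at hga
      exact ⟨g, hg, fun _ => hga⟩
    · exact ⟨f, fun _ _ => rfl, fun h => absurd h hB⟩
  refine ⟨fun v => if v ∈ B then g v else c v, fun v hv => by simp [hv], fun e he => ?_,
    fun hB a => ?_⟩
  · simp only [hx e he, hy e he, if_true]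
    rw [hg _ (Finset.mem_union_left _ (Finset.mem_image_of_mem _ he)),
      hg _ (Finset.mem_union_right _ (Finset.mem_image_of_mem _ he))]
    exact hsep e he
  · refine le_trans (Finset.card_le_card fun v hv => ?_) (hga hB a)
    rw [Finset.mem_filter] at hv ⊢
    exact ⟨hv.1, by simpa [hv.1] using hv.2⟩

end ColoringExtension

section Counting

variable {V : Type*}

lemma sum_powerset_card_le_one (X : Finset V) (z : ℝ) :
    ∑ A ∈ X.powerset, (if A.card ≤ 1 then z ^ A.card else 0) ≤ 1 + X.card * z := by
  rw [Finset.sum_powerset_apply_card (fun t => if t ≤ 1 then z ^ t else 0)]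
  rcases Nat.eq_zero_or_pos X.card with h | h
  · simp [h]
  · obtain ⟨s, hs⟩ := Nat.exists_eq_add_of_le' h
    rw [hs, Finset.sum_range_succ', Finset.sum_range_succ']
    simp only [show ∀ t, ¬ t + 1 + 1 ≤ 1 by omega, if_false]
    simp [add_comm]

variable [Fintype V]

/-- The vertices whose level lies in `J`. -/
noncomputable def levelSet (ℓ : V → ℕ) (J : Finset ℕ) : Finset V :=
  Finset.univ.filter fun v => ℓ v ∈ J

lemma sum_transversal_le (ℓ : V → ℕ) {N z : ℝ} (hz : 0 ≤ z) (J : Finset ℕ)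
    (hN : ∀ j ∈ J, ((levelSet ℓ {j}).card : ℝ) ≤ N) :
    ∑ U ∈ (levelSet ℓ J).powerset,
      (if ∀ j ∈ J, (U.filter fun v => ℓ v = j).card ≤ 1 then z ^ U.card else 0) ≤
      (1 + N * z) ^ J.card := by
  induction J using Finset.induction_on with
  | empty => simp [levelSet]
  | insert j J hj ih =>
    have hdisj : Disjoint (levelSet ℓ {j}) (levelSet ℓ J) := by
      simp only [levelSet]
      rw [Finset.disjoint_filter]
      intro v _ h1 h2
      rw [Finset.mem_singleton] at h1
      exact hj (h1 ▸ h2)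
    have hun : levelSet ℓ (insert j J) = levelSet ℓ {j} ∪ levelSet ℓ J := by
      ext v
      simp [levelSet]
    have hNj := hN j (Finset.mem_insert_self _ _)
    have ih' := ih fun i hi => hN i (Finset.mem_insert_of_mem hi)
    rw [hun, sum_powerset_union hdisj, Finset.card_insert_of_notMem hj, pow_succ']
    have hN0 : 0 ≤ N := (Nat.cast_nonneg _).trans hNj
    have h1 : ∑ A ∈ (levelSet ℓ {j}).powerset, (if A.card ≤ 1 then z ^ A.card else 0) ≤
        1 + N * z :=
      (sum_powerset_card_le_one _ z).trans (by gcongr)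
    refine le_trans ?_ (mul_le_mul h1 ih' (Finset.sum_nonneg fun U _ => by
      split_ifs <;> positivity) (by positivity))
    rw [Finset.sum_mul_sum]
    refine Finset.sum_le_sum fun A hA => Finset.sum_le_sum fun U hU => ?_
    rw [Finset.mem_powerset] at hA hU
    have hcard : (A ∪ U).card = A.card + U.card :=
      Finset.card_union_of_disjoint ((hdisj.mono_left hA).mono_right hU)
    split_ifs with h0 h2 h3 h3
    · rw [hcard, pow_add]
    · refine absurd (fun i hi => ?_) h3
      exact (Finset.card_le_card (Finset.filter_subset_filter _ Finset.subset_union_right)).trans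
        (h0 i (Finset.mem_insert_of_mem hi))
    · refine absurd ?_ h2
      refine le_trans (Finset.card_le_card fun v hv => ?_) (h0 j (Finset.mem_insert_self _ _))
      have := hA hv
      simp only [levelSet, Finset.mem_filter, Finset.mem_singleton] at this
      simp [hv, this.2]
    · refine absurd ?_ h2
      refine le_trans (Finset.card_le_card fun v hv => ?_) (h0 j (Finset.mem_insert_self _ _))
      have := hA hv
      simp only [levelSet, Finset.mem_filter, Finset.mem_singleton] at this
      simp [hv, this.2]
    all_goals positivity

/-- The `k`-sets that contain `x` and `y`, meet each level above `i` at most once, and are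
monochromatic below level `i`, are few. -/
lemma card_dangerous_le {k r m i : ℕ} (hr : 0 < r) (ℓ : V → ℕ) (c : V → Fin r) (J : Finset ℕ)
    (hJ : ∀ v, ℓ v < i ∨ ℓ v = i ∨ ℓ v ∈ J) {N Z z : ℝ} (hz : 0 ≤ z) (hZ : 0 ≤ Z)
    (hNi : ((levelSet ℓ {i}).card : ℝ) ≤ N)
    (hN : ∀ j ∈ J, ((levelSet ℓ {j}).card : ℝ) ≤ N)
    (hm : ∀ a, (Finset.univ.filter fun v => ℓ v < i ∧ c v = a).card ≤ m)
    (hchoose : ∀ t ≤ k, (m.choose (k - t) : ℝ) ≤ Z * z ^ t)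
    {x y : V} (hxy : x ≠ y) (hx : ℓ x = i) (hy : ℓ y = i) (hiJ : ∀ j ∈ J, i < j)
    (G : Finset (Finset V))
    (hG : ∀ e ∈ G, e.card = k ∧ x ∈ e ∧ y ∈ e ∧
      (∀ j ∈ J, (e.filter fun v => ℓ v = j).card ≤ 1) ∧
      ∀ v ∈ e, ∀ w ∈ e, ℓ v < i → ℓ w < i → c v = c w) :
    (G.card : ℝ) ≤ r * Z * z ^ 2 * (1 + N * z) ^ J.card * Real.exp (N * z) := by
  set X := (levelSet ℓ {i} \ {x, y}).powerset with hX
  set Y := (levelSet ℓ J).powerset.filter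
    (fun U => ∀ j ∈ J, (U.filter fun v => ℓ v = j).card ≤ 1) with hY
  set I := ((Finset.univ : Finset (Fin r)) ×ˢ (X ×ˢ Y)).filter
    (fun q => 2 + q.2.1.card + q.2.2.card ≤ k) with hI
  set C : Fin r → Finset V := fun a => Finset.univ.filter fun v => ℓ v < i ∧ c v = a with hC
  have hcover : G ⊆ I.biUnion fun q =>
      (Finset.powersetCard (k - (2 + q.2.1.card + q.2.2.card)) (C q.1)).image
        fun K => ({x, y} ∪ q.2.1 ∪ q.2.2) ∪ K := by
    intro e he
    obtain ⟨hek, hxe, hye, htr, hmono⟩ := hG e he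
    set A := e.filter (fun v => ℓ v = i ∧ v ≠ x ∧ v ≠ y) with hA
    set U := e.filter (fun v => ℓ v ∈ J) with hU
    set K := e.filter (fun v => ℓ v < i) with hK
    have hnotJ : i ∉ J := fun h => lt_irrefl _ (hiJ i h)
    have hdec : ({x, y} ∪ A ∪ U) ∪ K = e := by
      ext v
      simp only [hA, hU, hK, Finset.mem_union, Finset.mem_insert, Finset.mem_singleton,
        Finset.mem_filter]
      constructor
      · rintro ((((rfl | rfl) | h) | h) | h)
        exacts [hxe, hye, h.1, h.1, h.1]
      · intro hv
        rcases hJ v with h | h | h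
        · exact Or.inr ⟨hv, h⟩
        · by_cases h1 : v = x
          · exact Or.inl (Or.inl (Or.inl (Or.inl h1)))
          · by_cases h2 : v = y
            · exact Or.inl (Or.inl (Or.inl (Or.inr h2)))
            · exact Or.inl (Or.inl (Or.inr ⟨hv, h, h1, h2⟩))
        · exact Or.inl (Or.inr ⟨hv, h⟩)
    have hd1 : Disjoint ({x, y} : Finset V) A := by
      rw [Finset.disjoint_left]
      intro v hv hv'
      simp only [hA, Finset.mem_filter, Finset.mem_insert, Finset.mem_singleton] at hv hv'
      tauto
    have hd2 : Disjoint ({x, y} ∪ A) U := by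
      rw [Finset.disjoint_left]
      intro v hv hv'
      simp only [hA, hU, Finset.mem_union, Finset.mem_filter, Finset.mem_insert,
        Finset.mem_singleton] at hv hv'
      rcases hv with (rfl | rfl) | h
      · exact hnotJ (hx ▸ hv'.2)
      · exact hnotJ (hy ▸ hv'.2)
      · exact hnotJ (h.2.1 ▸ hv'.2)
    have hd3 : Disjoint ({x, y} ∪ A ∪ U) K := by
      rw [Finset.disjoint_left]
      intro v hv hv'
      simp only [hA, hU, hK, Finset.mem_union, Finset.mem_filter, Finset.mem_insert,
        Finset.mem_singleton] at hv hv'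
      rcases hv with ((rfl | rfl) | h) | h
      · omega
      · omega
      · omega
      · have := hiJ _ h.2
        omega
    have hcard : 2 + A.card + U.card + K.card = k := by
      rw [← hek, ← hdec, Finset.card_union_of_disjoint hd3, Finset.card_union_of_disjoint hd2,
        Finset.card_union_of_disjoint hd1, Finset.card_pair hxy]
    obtain ⟨a, ha⟩ : ∃ a, K ⊆ C a := by
      rcases K.eq_empty_or_nonempty with h | ⟨w, hw⟩
      · exact ⟨⟨0, hr⟩, by simp [h]⟩
      · refine ⟨c w, fun v hv => ?_⟩
        rw [hK, Finset.mem_filter] at hv hw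
        exact Finset.mem_filter.2 ⟨Finset.mem_univ _, hv.2, hmono v hv.1 w hw.1 hv.2 hw.2⟩
    rw [Finset.mem_biUnion]
    refine ⟨(a, A, U), ?_, ?_⟩
    · rw [hI, Finset.mem_filter]
      refine ⟨?_, by simp only; omega⟩
      simp only [Finset.mem_product, Finset.mem_univ, true_and, hX, hY, Finset.mem_powerset,
        Finset.mem_filter]
      refine ⟨fun v hv => ?_, fun v hv => ?_, fun j hj => ?_⟩
      · rw [hA, Finset.mem_filter] at hv
        simp [levelSet, hv.2]
      · rw [hU, Finset.mem_filter] at hv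
        simp [levelSet, hv.2]
      · exact (Finset.card_le_card (Finset.filter_subset_filter _
          (Finset.filter_subset _ _))).trans (htr j hj)
    · rw [Finset.mem_image]
      refine ⟨K, ?_, hdec⟩
      rw [Finset.mem_powersetCard]
      exact ⟨ha, by simp only; omega⟩
  have hN0 : 0 ≤ N := (Nat.cast_nonneg _).trans hNi
  have hcount : (G.card : ℝ) ≤ ∑ q ∈ I, Z * z ^ (2 + q.2.1.card + q.2.2.card) := by
    have h1 := (Finset.card_le_card hcover).trans Finset.card_biUnion_le
    refine (Nat.cast_le (α := ℝ).2 h1).trans ?_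
    push_cast
    refine Finset.sum_le_sum fun q hq => ?_
    have hqk : 2 + q.2.1.card + q.2.2.card ≤ k := (Finset.mem_filter.1 hq).2
    refine le_trans ?_ (hchoose _ hqk)
    refine Nat.cast_le.2 (Finset.card_image_le.trans ?_)
    rw [Finset.card_powersetCard]
    exact Nat.choose_le_choose _ (hm q.1)
  refine hcount.trans ?_
  calc ∑ q ∈ I, Z * z ^ (2 + q.2.1.card + q.2.2.card)
      ≤ ∑ q ∈ (Finset.univ : Finset (Fin r)) ×ˢ (X ×ˢ Y),
          Z * z ^ (2 + q.2.1.card + q.2.2.card) :=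
        Finset.sum_le_sum_of_subset_of_nonneg (Finset.filter_subset _ _)
          fun q _ _ => by positivity
    _ = r * (Z * z ^ 2 * ((∑ A ∈ X, z ^ A.card) * ∑ U ∈ Y, z ^ U.card)) := by
        rw [Finset.sum_product]
        simp only [Finset.sum_const, Finset.card_univ, Fintype.card_fin, nsmul_eq_mul]
        congr 1
        rw [Finset.sum_product, Finset.sum_mul_sum, Finset.mul_sum]
        refine Finset.sum_congr rfl fun A _ => ?_
        rw [Finset.mul_sum]
        refine Finset.sum_congr rfl fun U _ => ?_
        simp only
        ring
    _ ≤ r * (Z * z ^ 2 * (Real.exp (N * z) * (1 + N * z) ^ J.card)) := by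
        have hA : ∑ A ∈ X, z ^ A.card ≤ Real.exp (N * z) := by
          have h1 := Finset.sum_pow_mul_eq_add_pow z 1 (levelSet ℓ {i} \ {x, y})
          simp only [one_pow, mul_one] at h1
          rw [hX, h1]
          have h2 : ((levelSet ℓ {i} \ {x, y}).card : ℝ) ≤ N :=
            (Nat.cast_le.2 (Finset.card_le_card Finset.sdiff_subset)).trans hNi
          calc (z + 1) ^ (levelSet ℓ {i} \ {x, y}).card
              ≤ Real.exp z ^ (levelSet ℓ {i} \ {x, y}).card :=
                pow_le_pow_left₀ (by positivity) (Real.add_one_le_exp z) _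
            _ = Real.exp ((levelSet ℓ {i} \ {x, y}).card * z) := by
                rw [← Real.exp_nat_mul]
            _ ≤ Real.exp (N * z) := Real.exp_le_exp.2 (by gcongr)
        have hU : ∑ U ∈ Y, z ^ U.card ≤ (1 + N * z) ^ J.card := by
          rw [hY, Finset.sum_filter]
          exact sum_transversal_le ℓ hz J hN
        have hU0 : 0 ≤ ∑ U ∈ Y, z ^ U.card := Finset.sum_nonneg fun U _ => pow_nonneg hz _
        gcongr
    _ = r * Z * z ^ 2 * (1 + N * z) ^ J.card * Real.exp (N * z) := by ring

end Counting

section Levels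

variable {V : Type*}

/-- The largest level below `L` containing at least two vertices of `e`. -/
noncomputable def edgeLevel (ℓ : V → ℕ) (L : ℕ) (e : Finset V) : ℕ :=
  Nat.findGreatest (fun j => 2 ≤ (e.filter fun v => ℓ v = j).card) (L - 1)

lemma edgeLevel_lt (ℓ : V → ℕ) {L : ℕ} (hL : 0 < L) (e : Finset V) : edgeLevel ℓ L e < L := by
  have := Nat.findGreatest_le (P := fun j => 2 ≤ (e.filter fun v => ℓ v = j).card) (L - 1)
  rw [edgeLevel]
  omega

lemma two_le_card_filter_edgeLevel {ℓ : V → ℕ} {L : ℕ} (hℓ : ∀ v, ℓ v < L) {e : Finset V}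
    (he : L < e.card) : 2 ≤ (e.filter fun v => ℓ v = edgeLevel ℓ L e).card := by
  obtain ⟨j, hj, hj2⟩ := Finset.exists_lt_card_fiber_of_mul_lt_card_of_maps_to
    (s := e) (t := Finset.range L) (f := ℓ) (n := 1) (fun v _ => Finset.mem_range.2 (hℓ v))
    (by simpa using he)
  rw [Finset.mem_range] at hj
  exact Nat.findGreatest_spec (P := fun j => 2 ≤ (e.filter fun v => ℓ v = j).card)
    (show j ≤ L - 1 by omega) hj2

lemma card_filter_le_one_of_edgeLevel_lt {ℓ : V → ℕ} {L : ℕ} {e : Finset V} {j : ℕ}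
    (hj : edgeLevel ℓ L e < j) (hjL : j < L) : (e.filter fun v => ℓ v = j).card ≤ 1 := by
  have := Nat.findGreatest_is_greatest hj (show j ≤ L - 1 by omega)
  omega

variable [Fintype V]

/-- `c` is balanced on the levels below `i` and already separates two vertices below level `i`
in each `e ∈ E`. -/
def GoodStage (ℓ : V → ℕ) (r L m i : ℕ) (E : Finset (Finset V)) : Prop :=
  ∃ c : V → Fin r,
    (∀ j < i, j + 1 < L → ∀ a, ((levelSet ℓ {j}).filter fun v => c v = a).card ≤ m) ∧
    ∀ e ∈ E, ∃ v ∈ e, ∃ w ∈ e, ℓ v < i ∧ ℓ w < i ∧ c v ≠ c w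

lemma card_lower_color_class_le {ℓ : V → ℕ} {r L m i : ℕ} (hi : i < L) {c : V → Fin r}
    (hc : ∀ j < i, j + 1 < L → ∀ a, ((levelSet ℓ {j}).filter fun v => c v = a).card ≤ m)
    (a : Fin r) : (Finset.univ.filter fun v => ℓ v < i ∧ c v = a).card ≤ i * m := by
  rw [Finset.card_eq_sum_card_fiberwise (f := ℓ) (t := Finset.range i)
    (fun v hv => by simpa using (Finset.mem_filter.1 hv).2.1)]
  calc _ ≤ ∑ _j ∈ Finset.range i, m := by
        refine Finset.sum_le_sum fun j hj => ?_
        rw [Finset.mem_range] at hj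
        refine (Finset.card_le_card fun v hv => ?_).trans (hc j hj (by omega) a)
        simp only [Finset.mem_filter, levelSet, Finset.mem_univ, true_and,
          Finset.mem_singleton] at hv ⊢
        exact ⟨hv.2, hv.1.2⟩
    _ = i * m := by simp

lemma subsetProb_not_goodStage_succ_le [Nonempty V] {k r L m i : ℕ} (hr : 2 ≤ r) (hLk : L < k)
    (hm : 1 ≤ m) (hi : i < L) {ℓ : V → ℕ} (hℓ : ∀ v, ℓ v < L) {p N z Z lam : ℝ} (hp0 : 0 ≤ p)
    (hp1 : p ≤ 1) (hz : 0 ≤ z) (hZ : 0 ≤ Z)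
    (hbal : i + 1 < L → (levelSet ℓ {i}).card ≤ r * m)
    (hN : ∀ j < L, ((levelSet ℓ {j}).card : ℝ) ≤ N)
    (hchoose : ∀ t ≤ k, ((i * m).choose (k - t) : ℝ) ≤ Z * z ^ t)
    (hlam : p * N * (r * Z * z ^ 2 * (1 + N * z) ^ (L - 1 - i) * Real.exp (N * z)) ≤ lam)
    (hlam2 : lam ≤ 1 / 2) {E : Finset (Finset V)} (hE : GoodStage ℓ r L m i E) :
    subsetProb p ((Finset.univ.powersetCard k).filter fun e => edgeLevel ℓ L e = i)
      (fun F => ¬ GoodStage ℓ r L m (i + 1) (E ∪ F)) ≤ 2 * lam + 2 * (N / m) * lam := by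
  obtain ⟨c, hbc, hcE⟩ := hE
  set Ω := (Finset.univ.powersetCard k).filter fun e : Finset V => edgeLevel ℓ L e = i with hΩ
  set B := levelSet ℓ {i} with hB
  set M := r * Z * z ^ 2 * (1 + N * z) ^ (L - 1 - i) * Real.exp (N * z) with hMdef
  have hmemB : ∀ v, v ∈ B ↔ ℓ v = i := fun v => by simp [hB, levelSet]
  have hN0 : 0 ≤ N := (Nat.cast_nonneg _).trans (hN i hi)
  have hM0 : 0 ≤ M := by positivity
  have hlam0 : 0 ≤ lam := le_trans (by positivity) hlam
  have hpair : ∀ e : Finset V, ∃ q : V × V, e ∈ Ω →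
      q.1 ∈ e ∧ q.2 ∈ e ∧ ℓ q.1 = i ∧ ℓ q.2 = i ∧ q.1 ≠ q.2 := by
    intro e
    by_cases he : e ∈ Ω
    · rw [hΩ, Finset.mem_filter, Finset.mem_powersetCard] at he
      have h2 := two_le_card_filter_edgeLevel hℓ (e := e) (by omega)
      rw [he.2] at h2
      obtain ⟨x, hx, y, hy, hxy⟩ := Finset.one_lt_card.1 h2
      rw [Finset.mem_filter] at hx hy
      exact ⟨(x, y), fun _ => ⟨hx.1, hy.1, hx.2, hy.2, hxy⟩⟩
    · exact ⟨Classical.arbitrary _, fun h => absurd h he⟩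
  choose q hq using hpair
  set G := Ω.filter fun e => ∀ v ∈ e, ∀ w ∈ e, ℓ v < i → ℓ w < i → c v = c w with hG
  have hGΩ : G ⊆ Ω := Finset.filter_subset _ _
  have hfib : ∀ a b, ((G.filter fun e => s((q e).1, (q e).2) = s(a, b)).card : ℝ) ≤ M := by
    intro a b
    rcases (G.filter fun e => s((q e).1, (q e).2) = s(a, b)).eq_empty_or_nonempty with h | h
    · rw [h]
      simpa using hM0
    have hprop : ∀ e ∈ G.filter (fun e => s((q e).1, (q e).2) = s(a, b)),
        (a ∈ e ∧ b ∈ e) ∧ a ≠ b ∧ ℓ a = i ∧ ℓ b = i := by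
      intro e he
      rw [Finset.mem_filter] at he
      have hqe := hq e (hGΩ he.1)
      rcases Sym2.eq_iff.1 he.2 with ⟨h1, h2⟩ | ⟨h1, h2⟩
      · rw [← h1, ← h2]
        exact ⟨⟨hqe.1, hqe.2.1⟩, hqe.2.2.2.2, hqe.2.2.1, hqe.2.2.2.1⟩
      · rw [← h1, ← h2]
        exact ⟨⟨hqe.2.1, hqe.1⟩, hqe.2.2.2.2.symm, hqe.2.2.2.1, hqe.2.2.1⟩
    obtain ⟨e₀, he₀⟩ := h
    obtain ⟨-, hab, hla, hlb⟩ := hprop e₀ he₀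
    have hJ : (Finset.Ioo i L).card = L - 1 - i := by
      rw [Nat.card_Ioo]
      omega
    rw [hMdef, ← hJ]
    refine card_dangerous_le (k := k) (by omega) ℓ c (Finset.Ioo i L) (fun v => ?_) hz hZ
      (hN i hi) (fun j hj => hN j (Finset.mem_Ioo.1 hj).2)
      (card_lower_color_class_le hi hbc) hchoose hab hla hlb
      (fun j hj => (Finset.mem_Ioo.1 hj).1) _ fun e he => ?_
    · have := hℓ v
      rw [Finset.mem_Ioo]
      omega
    · have hpe := hprop e he
      rw [Finset.mem_filter, hG, Finset.mem_filter, hΩ, Finset.mem_filter,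
        Finset.mem_powersetCard] at he
      refine ⟨he.1.1.1.2, hpe.1.1, hpe.1.2, fun j hj => ?_, he.1.2⟩
      rw [Finset.mem_Ioo] at hj
      exact card_filter_le_one_of_edgeLevel_lt (by rw [he.1.1.2]; exact hj.1) hj.2
  have hGcard : (G.card : ℝ) ≤ N * N * M := by
    have h1 := Finset.card_eq_sum_card_fiberwise (f := q) (s := G) (t := B ×ˢ B) (fun e he => by
      have := hq e (hGΩ he)
      simp [hmemB, this.2.2.1, this.2.2.2.1])
    rw [h1]
    push_cast
    calc _ ≤ ∑ _x ∈ B ×ˢ B, M := by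
          refine Finset.sum_le_sum fun x _ => le_trans ?_ (hfib x.1 x.2)
          refine Nat.cast_le.2 (Finset.card_le_card fun e he => ?_)
          rw [Finset.mem_filter] at he ⊢
          exact ⟨he.1, by rw [he.2]⟩
      _ = B.card * B.card * M := by simp
      _ ≤ N * N * M := by
          have := hN i hi
          gcongr
  have hcyc : subsetProb p Ω (fun F => ¬ (pairGraph (fun e => (q e).1) (fun e => (q e).2)
      (F ∩ G)).IsAcyclic) ≤ 2 * lam := by
    refine subsetProb_not_isAcyclic_le hp0 hp1 hGΩ (B := B) hM0
      (fun e he => (hmemB _).2 (hq e (hGΩ he)).2.2.1)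
      (fun e he => (hmemB _).2 (hq e (hGΩ he)).2.2.2.1) hfib (le_trans ?_ hlam) hlam2
    have := hN i hi
    gcongr
  have hm0 : (0 : ℝ) < m := by exact_mod_cast hm
  have hmany : subsetProb p Ω (fun F => (m / 2 : ℝ) ≤ ((F ∩ G).card : ℝ)) ≤
      2 * (N / m) * lam := by
    have h1 := mul_subsetProb_card_le hp0 hp1 hGΩ (m / 2 : ℝ)
    have h2 : p * G.card ≤ N * lam := by
      calc p * G.card ≤ p * (N * N * M) := by gcongr
        _ = N * (p * N * M) := by ring
        _ ≤ N * lam := by gcongr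
    have h3 : 2 * (N / m) * lam = N * lam / (m / 2) := by field_simp
    rw [h3, le_div_iff₀ (by positivity), mul_comm]
    refine le_trans (le_of_eq ?_) (h1.trans h2)
    congr!
  refine le_trans ?_ (add_le_add hcyc hmany)
  refine le_trans ?_ (subsetProb_or_le hp0 hp1 _ _ _)
  refine subsetProb_mono hp0 hp1 fun F hF hbad => ?_
  by_contra hgood
  push Not at hgood
  refine hbad ?_
  have hlt : 2 * (F ∩ G).card ≤ m := by
    have : (2 * (F ∩ G).card : ℝ) < m := by linarith [hgood.2]
    exact_mod_cast this.le
  have hFG : F ∩ G ⊆ Ω := Finset.inter_subset_right.trans hGΩ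
  obtain ⟨g, hgc, hgsep, hgbal⟩ := exists_recoloring hr c (B := B)
    (fun e he => (hmemB _).2 (hq e (hFG he)).2.2.1)
    (fun e he => (hmemB _).2 (hq e (hFG he)).2.2.2.1)
    (fun e he => (hq e (hFG he)).2.2.2.2) hgood.1 hlt
  have hgc' : ∀ v, ℓ v < i → g v = c v := fun v hv => hgc v fun h => by
    rw [hmemB] at h
    omega
  refine ⟨g, fun j hj hjL a => ?_, fun e he => ?_⟩
  · rcases Nat.lt_succ_iff_lt_or_eq.1 hj with h | rfl
    · rw [Finset.filter_congr fun v hv => by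
        have : ℓ v = j := by simpa [levelSet] using hv
        rw [hgc' v (by omega)]]
      exact hbc j h hjL a
    · exact hgbal (hbal hjL) a
  · by_cases hlow : ∃ v ∈ e, ∃ w ∈ e, ℓ v < i ∧ ℓ w < i ∧ c v ≠ c w
    · obtain ⟨v, hv, w, hw, hvi, hwi, hne⟩ := hlow
      exact ⟨v, hv, w, hw, by omega, by omega, by rwa [hgc' v hvi, hgc' w hwi]⟩
    · have heF : e ∈ F := (Finset.mem_union.1 he).resolve_left fun h => hlow (hcE e h)
      have heG : e ∈ F ∩ G := by
        refine Finset.mem_inter.2 ⟨heF, Finset.mem_filter.2 ⟨hF heF, ?_⟩⟩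
        push Not at hlow
        exact hlow
      have hqe := hq e (hF heF)
      exact ⟨_, hqe.1, _, hqe.2.1, by omega, by omega, hgsep e heG⟩

/-- If the vertices are split into `L < k` levels of bounded size, the random `k`-uniform
hypergraph fails to be `r`-colorable with probability at most a multiple of `∑ lam i`. -/
lemma subsetProb_not_rColorable_le [Nonempty V] {k r L m : ℕ} (hr : 2 ≤ r) (hL : 0 < L)
    (hLk : L < k) (hm : 1 ≤ m) {ℓ : V → ℕ} (hℓ : ∀ v, ℓ v < L) {p N z : ℝ} {Z lam : ℕ → ℝ}
    (hp0 : 0 ≤ p) (hp1 : p ≤ 1) (hz : 0 ≤ z) (hZ : ∀ i, 0 ≤ Z i)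
    (hbal : ∀ i, i + 1 < L → (levelSet ℓ {i}).card ≤ r * m)
    (hN : ∀ j < L, ((levelSet ℓ {j}).card : ℝ) ≤ N)
    (hchoose : ∀ i < L, ∀ t ≤ k, ((i * m).choose (k - t) : ℝ) ≤ Z i * z ^ t)
    (hlam : ∀ i < L,
      p * N * (r * Z i * z ^ 2 * (1 + N * z) ^ (L - 1 - i) * Real.exp (N * z)) ≤ lam i)
    (hlam0 : ∀ i, 0 ≤ lam i) (hlam2 : ∀ i, lam i ≤ 1 / 2) :
    subsetProb p ((Finset.univ : Finset V).powersetCard k) (fun E => ¬ RColorable r E) ≤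
      (2 + 2 * (N / m)) * ∑ i ∈ Finset.range L, lam i := by
  have hN0 : 0 ≤ N := (Nat.cast_nonneg _).trans (hN 0 hL)
  have h := subsetProb_levels_not_le hp0 hp1 ((Finset.univ : Finset V).powersetCard k)
    (edgeLevel ℓ L) (GoodStage ℓ r L m) (fun i => 2 * lam i + 2 * (N / m) * lam i) L
    (fun i => by have := hlam0 i; positivity)
    ⟨fun _ => ⟨0, by omega⟩, by simp, by simp⟩
    (fun i hi E _ hE => by
      have hstep := subsetProb_not_goodStage_succ_le hr hLk hm hi hℓ hp0 hp1 hz (hZ i)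
        (hbal i) hN (hchoose i hi) (hlam i hi) (hlam2 i) hE
      refine le_trans (le_of_eq ?_) hstep
      congr!)
  rw [Finset.filter_true_of_mem fun e _ => edgeLevel_lt ℓ hL e] at h
  have hsum : ∑ i ∈ Finset.range L, (2 * lam i + 2 * (N / m) * lam i) =
      (2 + 2 * (N / m)) * ∑ i ∈ Finset.range L, lam i := by
    rw [Finset.mul_sum]
    exact Finset.sum_congr rfl fun i _ => by ring
  rw [hsum] at h
  refine (subsetProb_mono hp0 hp1 fun E _ hE => ?_).trans h
  contrapose! hE
  obtain ⟨c, -, hc⟩ := hE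
  refine ⟨c, fun e he hmono => ?_⟩
  obtain ⟨v, hv, w, hw, -, -, hne⟩ := hc e he
  exact hne (hmono v hv w hw)

end Levels

lemma pow_div_two_mul_factorial_le_choose {n k : ℕ} (hk : 1 ≤ k) (hn : 2 * k ^ 2 ≤ n) :
    (n : ℝ) ^ k / (2 * k.factorial) ≤ n.choose k := by
  have hkn : k ≤ n := by nlinarith
  have hn0 : (0 : ℝ) < n := by
    have : 0 < n := by omega
    exact_mod_cast this
  have hn' : (2 : ℝ) * k ^ 2 ≤ n := by exact_mod_cast hn
  have h1 : ((n : ℝ) - k) ^ k ≤ n.choose k * k.factorial := by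
    have := Nat.pow_sub_le_descFactorial n k
    rw [Nat.descFactorial_eq_factorial_mul_choose] at this
    have h2 : (n - k) ^ k ≤ k.factorial * n.choose k :=
      (Nat.pow_le_pow_left (by omega) k).trans this
    have h3 : ((n - k : ℕ) : ℝ) ^ k ≤ k.factorial * n.choose k := by exact_mod_cast h2
    rwa [Nat.cast_sub hkn, mul_comm (k.factorial : ℝ)] at h3
  have hkn' : (k : ℝ) ≤ n := by exact_mod_cast hkn
  have hB := one_add_mul_le_pow (a := -(k / n : ℝ)) (by
    have : (k : ℝ) / n ≤ 1 := by rw [div_le_one hn0]; exact hkn'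
    linarith) k
  have hhalf : (1 / 2 : ℝ) ≤ (1 + -(k / n : ℝ)) ^ k := by
    refine le_trans ?_ hB
    have : (k : ℝ) * (k / n) ≤ 1 / 2 := by
      rw [mul_div_assoc', div_le_iff₀ hn0]
      nlinarith
    linarith
  have h4 : (n : ℝ) ^ k / 2 ≤ ((n : ℝ) - k) ^ k := by
    have : ((n : ℝ) - k) = n * (1 + -(k / n : ℝ)) := by field_simp; ring
    rw [this, mul_pow]
    have := mul_le_mul_of_nonneg_left hhalf (pow_nonneg hn0.le k)
    linarith
  rw [div_le_iff₀ (by positivity)]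
  linarith

lemma choose_sub_le {x k t : ℕ} {X : ℝ} (hX : 0 < X) {y : ℝ} (hy : y ≤ 1)
    (hx : (x : ℝ) ≤ X * Real.exp (-y)) (ht : t ≤ k) :
    (x.choose (k - t) : ℝ) ≤
      X ^ k * Real.exp (-(y * k)) / k.factorial * (Real.exp 1 * k / X) ^ t := by
  have h1 : (x.choose (k - t) : ℝ) ≤ (x : ℝ) ^ (k - t) / (k - t).factorial :=
    Nat.choose_le_pow_div _ _
  have h2 : (k.factorial : ℝ) ≤ k ^ t * (k - t).factorial := by
    have h := Nat.factorial_mul_descFactorial ht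
    have h' : k.descFactorial t ≤ k ^ t := Nat.descFactorial_le_pow k t
    have : k.factorial ≤ k ^ t * (k - t).factorial := by
      rw [← h, mul_comm]
      exact Nat.mul_le_mul_right _ h'
    exact_mod_cast this
  have h3 : (x : ℝ) ^ (k - t) ≤ X ^ (k - t) * (Real.exp (-(y * k)) * Real.exp 1 ^ t) := by
    refine (pow_le_pow_left₀ (Nat.cast_nonneg _) hx _).trans ?_
    rw [mul_pow, ← Real.exp_nat_mul, ← Real.exp_nat_mul, ← Real.exp_add, Nat.cast_sub ht]
    refine mul_le_mul_of_nonneg_left (Real.exp_le_exp.2 ?_) (by positivity)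
    nlinarith [Nat.cast_nonneg (α := ℝ) t]
  have hXk : X ^ k = X ^ (k - t) * X ^ t := by rw [← pow_add]; congr 1; omega
  refine h1.trans ?_
  rw [div_le_iff₀ (by positivity), div_pow, mul_pow, hXk]
  have hf : (0 : ℝ) < k.factorial := by positivity
  calc (x : ℝ) ^ (k - t) ≤ X ^ (k - t) * (Real.exp (-(y * k)) * Real.exp 1 ^ t) * 1 := by
        rw [mul_one]; exact h3
    _ ≤ X ^ (k - t) * (Real.exp (-(y * k)) * Real.exp 1 ^ t) *
        (k ^ t * (k - t).factorial / k.factorial) := by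
        refine mul_le_mul_of_nonneg_left ?_ (by positivity)
        rwa [one_le_div hf]
    _ = _ := by field_simp

/-- The level of a vertex: consecutive blocks of `b` vertices, the last one taking the rest. -/
def blockLevel (b L : ℕ) {n : ℕ} (v : Fin n) : ℕ := min (v / b) (L - 1)

lemma blockLevel_lt {b L n : ℕ} (hL : 0 < L) (v : Fin n) : blockLevel b L v < L := by
  rw [blockLevel]
  omega

lemma card_levelSet_blockLevel_le {b L n i : ℕ} (hb : 0 < b) (hi : i + 1 < L) :
    (levelSet (blockLevel b L (n := n)) {i}).card ≤ b := by
  have : ((levelSet (blockLevel b L (n := n)) {i}).map Fin.valEmbedding) ⊆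
      Finset.Ico (i * b) (i * b + b) := by
    intro x hx
    simp only [levelSet, Finset.mem_map, Finset.mem_filter, Finset.mem_univ, true_and,
      Finset.mem_singleton, Fin.valEmbedding_apply, blockLevel] at hx
    obtain ⟨v, hv, rfl⟩ := hx
    have : (v : ℕ) / b = i := by omega
    rw [Finset.mem_Ico]
    have h1 := Nat.div_add_mod (v : ℕ) b
    have h2 := Nat.mod_lt (v : ℕ) hb
    rw [this, mul_comm] at h1
    omega
  have h := Finset.card_le_card this
  rw [Finset.card_map, Nat.card_Ico] at h
  omega

lemma card_levelSet_blockLevel_top_le {b L n i : ℕ} (hb : 0 < b) (hi : i + 1 = L) :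
    (levelSet (blockLevel b L (n := n)) {i}).card ≤ n - i * b := by
  have : ((levelSet (blockLevel b L (n := n)) {i}).map Fin.valEmbedding) ⊆
      Finset.Ico (i * b) n := by
    intro x hx
    simp only [levelSet, Finset.mem_map, Finset.mem_filter, Finset.mem_univ, true_and,
      Finset.mem_singleton, Fin.valEmbedding_apply, blockLevel] at hx
    obtain ⟨v, hv, rfl⟩ := hx
    have : i ≤ (v : ℕ) / b := by omega
    rw [Finset.mem_Ico]
    exact ⟨(Nat.le_div_iff_mul_le hb).1 this, v.2⟩
  have h := Finset.card_le_card this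
  rwa [Finset.card_map, Nat.card_Ico] at h

lemma one_add_mul_exp_neg_le_half {r w : ℝ} (hr : 2 ≤ r) (hw : 8 * r ≤ w) :
    (1 + 2 * Real.exp 1 * r * w) * Real.exp (-w) ≤ 1 / 2 := by
  have h := Real.pow_div_factorial_le_exp w (by linarith) 4
  have he := Real.exp_one_lt_d9
  have hw16 : 16 ≤ w := by linarith
  norm_num [Nat.factorial] at h
  have h1 : 1 + 2 * Real.exp 1 * r * w ≤ 1 + w ^ 2 := by
    have h3 : 2 * Real.exp 1 * r ≤ w := by nlinarith
    nlinarith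
  have h2 : 2 * (1 + w ^ 2) ≤ Real.exp w := by
    refine le_trans ?_ h
    have : 256 ≤ w ^ 2 := by nlinarith
    nlinarith
  rw [Real.exp_neg, ← div_eq_mul_inv, div_le_iff₀ (Real.exp_pos _)]
  linarith

lemma dangerous_weight_le {n k r L u : ℕ} {p c : ℝ} (hr : 2 ≤ r) (hk : 1 ≤ k) (hL : 0 < L)
    (hLk : 8 * r * L ≤ k) (hkL : k ≤ 16 * r * L) (hn : 2 * k ^ 2 ≤ n) (hc : 0 ≤ c)
    (hp : p ≤ c * (n / n.choose k)) :
    p * (2 * n / L) * (r * ((n / r : ℝ) ^ k * Real.exp (-((u + 1) / L * k)) / k.factorial) *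
      (Real.exp 1 * k / (n / r)) ^ 2 * (1 + 2 * n / L * (Real.exp 1 * k / (n / r))) ^ u *
        Real.exp (2 * n / L * (Real.exp 1 * k / (n / r)))) ≤
      32 * r ^ 3 * Real.exp (87 * r ^ 2) * (c * (k / r ^ k)) * (1 / 2) ^ u := by
  have hn0 : (0 : ℝ) < n := by
    have : 0 < n := by nlinarith
    exact_mod_cast this
  have hr0 : (0 : ℝ) < r := by
    have : 0 < r := by omega
    exact_mod_cast this
  have hr2 : (2 : ℝ) ≤ r := by exact_mod_cast hr
  have hL0 : (0 : ℝ) < L := by exact_mod_cast hL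
  have hk0 : (0 : ℝ) < k := by exact_mod_cast hk
  have hC := pow_div_two_mul_factorial_le_choose hk hn
  have hp' : p ≤ c * n * (2 * k.factorial) / n ^ k := by
    refine hp.trans ?_
    rw [mul_assoc, mul_div_assoc]
    refine mul_le_mul_of_nonneg_left ?_ hc
    calc (n : ℝ) / n.choose k ≤ n / ((n : ℝ) ^ k / (2 * k.factorial)) := by gcongr
      _ = _ := by field_simp
  set w : ℝ := k / L with hw
  have hw8 : 8 * r ≤ w := by
    rw [hw, le_div_iff₀ hL0]
    exact_mod_cast hLk
  have hw16 : w ≤ 16 * r := by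
    rw [hw, div_le_iff₀ hL0]
    exact_mod_cast hkL
  have hNz : 2 * n / L * (Real.exp 1 * k / (n / r)) = 2 * Real.exp 1 * r * w := by
    rw [hw]; field_simp
  rw [hNz]
  have he := Real.exp_one_lt_d9
  have hexp : Real.exp (-((u + 1) / L * k)) = Real.exp (-w) * Real.exp (-w) ^ u := by
    rw [← Real.exp_nat_mul, ← Real.exp_add]
    congr 1
    rw [hw]; field_simp; ring
  have hw0 : 0 < w := by linarith
  have hu : ((1 + 2 * Real.exp 1 * r * w) * Real.exp (-w)) ^ u ≤ (1 / 2) ^ u :=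
    pow_le_pow_left₀ (by positivity) (one_add_mul_exp_neg_le_half hr2 hw8) u
  have hwe : w * Real.exp (-w) ≤ 1 := by
    rw [Real.exp_neg, ← div_eq_mul_inv, div_le_one (Real.exp_pos _)]
    linarith [Real.add_one_le_exp w]
  have he2 : 4 * Real.exp 1 ^ 2 ≤ 32 := by nlinarith [Real.exp_pos 1]
  have hE : Real.exp (2 * Real.exp 1 * r * w) ≤ Real.exp (87 * r ^ 2) := by
    refine Real.exp_le_exp.2 ?_
    have h1 : 2 * Real.exp 1 * r * w ≤ 2 * Real.exp 1 * r * (16 * r) := by gcongr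
    nlinarith [sq_nonneg (r : ℝ)]
  calc _ ≤ c * n * (2 * k.factorial) / n ^ k * (2 * n / L) *
        (r * ((n / r : ℝ) ^ k * (Real.exp (-w) * Real.exp (-w) ^ u) / k.factorial) *
        (Real.exp 1 * k / (n / r)) ^ 2 * (1 + 2 * Real.exp 1 * r * w) ^ u *
        Real.exp (2 * Real.exp 1 * r * w)) := by
        rw [hexp]
        gcongr
    _ = 4 * Real.exp 1 ^ 2 * r ^ 3 * Real.exp (2 * Real.exp 1 * r * w) * (c * (k / r ^ k)) *
        (w * Real.exp (-w)) * ((1 + 2 * Real.exp 1 * r * w) * Real.exp (-w)) ^ u := by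
        rw [mul_pow _ (Real.exp (-w)) u, div_pow (n : ℝ) (r : ℝ) k]
        have hwk : (k : ℝ) = w * L := by rw [hw]; field_simp
        have hkf : (k.factorial : ℝ) ≠ 0 := by positivity
        generalize Real.exp (-w) ^ u = A
        generalize (1 + 2 * Real.exp 1 * r * w) ^ u = B
        generalize Real.exp (2 * Real.exp 1 * r * w) = D
        generalize (k.factorial : ℝ) = F at hkf ⊢
        generalize Real.exp (-w) = G
        have hnk : (n : ℝ) ^ k ≠ 0 := by positivity
        have hrk : (r : ℝ) ^ k ≠ 0 := by positivity
        generalize (n : ℝ) ^ k = P at hnk ⊢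
        generalize (r : ℝ) ^ k = Q at hrk ⊢
        rw [hwk]
        field_simp
        ring
    _ ≤ 32 * r ^ 3 * Real.exp (87 * r ^ 2) * (c * (k / r ^ k)) * 1 * (1 / 2) ^ u := by
        gcongr
    _ = _ := by ring

set_option maxHeartbeats 2000000 in
/-- A quantitative form of `r`-colorability of the random hypergraph `H(n,k,p)`, together with the
trivial upper bound, which needs `p ≤ 1`. -/
lemma one_sub_hyperProb_rColorable_le_and_le_one {n k r : ℕ} {p c : ℝ} (hr : 2 ≤ r) (hk : 8 * r ≤ k)
    (hn : 2 * r ^ 2 * k ^ 2 ≤ n) (hc : 0 ≤ c) (hp0 : 0 ≤ p) (hp : p ≤ c * (n / n.choose k))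
    (hsmall : 32 * r ^ 3 * Real.exp (87 * r ^ 2) * (c * (k / r ^ k)) ≤ 1 / 2) :
    1 - hyperProb n k p (RColorable r) ≤
      (2 + 8 * r) * (2 * (32 * r ^ 3 * Real.exp (87 * r ^ 2) * (c * (k / r ^ k)))) ∧
    hyperProb n k p (RColorable r) ≤ 1 := by
  set Λ : ℝ := 32 * r ^ 3 * Real.exp (87 * r ^ 2) * (c * (k / r ^ k)) with hΛ
  have hr0 : 0 < r := by omega
  have hk0 : 0 < k := by omega
  have hnk : 2 * k ^ 2 ≤ n := by nlinarith [Nat.one_le_pow 2 r hr0, Nat.one_le_pow 2 k hk0]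
  have hn0 : 0 < n := by nlinarith
  have hΛ0 : 0 ≤ Λ := by positivity
  have hrR : (2 : ℝ) ≤ r := by exact_mod_cast hr
  have hnR : (0 : ℝ) < n := by exact_mod_cast hn0
  have hkR : (0 : ℝ) < k := by exact_mod_cast hk0
  have : Nonempty (Fin n) := ⟨⟨0, hn0⟩⟩
  obtain ⟨L, hL0, hLk, hkL⟩ : ∃ L : ℕ, 0 < L ∧ 8 * r * L ≤ k ∧ k ≤ 16 * r * L := by
    refine ⟨k / (8 * r), Nat.div_pos hk (by omega), Nat.mul_div_le _ _, ?_⟩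
    have h1 := Nat.lt_mul_div_succ k (show 0 < 8 * r by omega)
    have h2 : 1 ≤ k / (8 * r) := Nat.div_pos hk (by omega)
    nlinarith
  have hLk' : L < k := by nlinarith
  have hrLn : 2 * (r * L ^ 2) ≤ n := by
    have h1 : L ^ 2 ≤ k ^ 2 := Nat.pow_le_pow_left hLk'.le 2
    have h2 : r ≤ r ^ 2 := by nlinarith
    have h3 : r * L ^ 2 ≤ r ^ 2 * k ^ 2 := Nat.mul_le_mul h2 h1
    nlinarith
  have hrLn' : 2 * (r * L) ≤ n := by nlinarith [Nat.mul_le_mul_left r (show L ≤ L ^ 2 by nlinarith)]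
  have hLR : (0 : ℝ) < L := by exact_mod_cast hL0
  set m := n / (r * L) with hm
  have hrL : 0 < r * L := Nat.mul_pos hr0 hL0
  have hm1 : 1 ≤ m := Nat.div_pos (by omega) hrL
  have hmle : r * L * m ≤ n := Nat.mul_div_le _ _
  have hmlt : n < r * L * m + r * L := Nat.lt_mul_div_succ n hrL
  have hmR : (0 : ℝ) < m := by exact_mod_cast hm1
  have hmleR : (r : ℝ) * L * m ≤ n := by exact_mod_cast hmle
  have hrm : 0 < r * m := Nat.mul_pos hr0 hm1
  have hp1 : p ≤ 1 := by
    have hck : c ≤ r ^ k := by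
      have h1 : c * (k / r ^ k) ≤ Λ := by
        rw [hΛ]
        refine le_mul_of_one_le_left (by positivity) ?_
        have h2 : (1 : ℝ) ≤ Real.exp (87 * r ^ 2) := Real.one_le_exp (by positivity)
        have h3 : (1 : ℝ) ≤ r ^ 3 := one_le_pow₀ (by linarith)
        nlinarith
      have h2 : c * (k / r ^ k) ≤ 1 := by linarith
      rw [← mul_div_assoc, div_le_one (by positivity)] at h2
      have : (1 : ℝ) ≤ k := by exact_mod_cast hk0
      nlinarith
    have hC := pow_div_two_mul_factorial_le_choose hk0 hnk
    have hf : (k.factorial : ℝ) ≤ k ^ k := by exact_mod_cast Nat.factorial_le_pow k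
    have hnR' : (2 : ℝ) * r ^ 2 * k ^ 2 ≤ n := by exact_mod_cast hn
    have hq : r * k / (n : ℝ) ≤ 1 := by
      rw [div_le_one hnR]
      have : (1 : ℝ) ≤ r * k := by
        have : (1 : ℝ) ≤ k := by exact_mod_cast hk0
        nlinarith
      nlinarith
    calc p ≤ c * (n / n.choose k) := hp
      _ ≤ r ^ k * (n / ((n : ℝ) ^ k / (2 * k ^ k))) := by
          gcongr
          refine le_trans ?_ hC
          gcongr
      _ = 2 * n * (r * k / n) ^ k := by
          rw [div_pow, mul_pow]
          field_simp
      _ ≤ 2 * n * (r * k / n) ^ 2 := by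
          gcongr 2 * n * ?_
          exact pow_le_pow_of_le_one (by positivity) hq (by omega)
      _ = 2 * r ^ 2 * k ^ 2 / n := by field_simp
      _ ≤ 1 := by rwa [div_le_one hnR]
  have hX : (0 : ℝ) < n / r := by positivity
  refine ⟨?_, subsetProb_le_one hp0 hp1 _ _⟩
  have hmain := subsetProb_not_rColorable_le (V := Fin n) (k := k) (m := m) (p := p)
    (ℓ := blockLevel (r * m) L) (N := 2 * n / L) (z := Real.exp 1 * k / (n / r))
    (Z := fun i => (n / r : ℝ) ^ k * Real.exp (-(((L - 1 - i : ℕ) + 1 : ℝ) / L * k)) / k.factorial)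
    (lam := fun i => Λ * (1 / 2) ^ (L - 1 - i)) hr hL0 hLk' hm1
    (fun v => blockLevel_lt hL0 v) hp0 hp1 (by positivity) (fun i => by positivity)
    (fun i hi => card_levelSet_blockLevel_le hrm hi) (fun i hi => ?_) (fun i hi t ht => ?_)
    (fun i hi => dangerous_weight_le hr hk0 hL0 hLk hkL hnk hc hp)
    (fun i => by positivity) (fun i => ?_)
  · have h1 := subsetProb_add_not (p := p) ((Finset.univ : Finset (Fin n)).powersetCard k) (RColorable r)
    have h2 : hyperProb n k p (RColorable r) =
        subsetProb p ((Finset.univ : Finset (Fin n)).powersetCard k) (RColorable r) := rfl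
    have hNm : 2 * n / L / m ≤ (4 * r : ℝ) := by
      rw [div_div, div_le_iff₀ (by positivity)]
      have : n ≤ 2 * (r * L * m) := by omega
      have : (n : ℝ) ≤ 2 * (r * L * m) := by exact_mod_cast this
      nlinarith
    have hsum : ∑ i ∈ Finset.range L, Λ * (1 / 2 : ℝ) ^ (L - 1 - i) ≤ 2 * Λ := by
      rw [Finset.sum_range_reflect (fun i => Λ * (1 / 2 : ℝ) ^ i), ← Finset.mul_sum, mul_comm]
      exact mul_le_mul_of_nonneg_right (sum_geometric_two_le L) hΛ0
    calc 1 - hyperProb n k p (RColorable r) =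
        subsetProb p ((Finset.univ : Finset (Fin n)).powersetCard k)
          (fun E => ¬ RColorable r E) := by
          rw [h2]; linarith
      _ ≤ (2 + 2 * (4 * r)) * (2 * Λ) := by
          refine hmain.trans ?_
          refine mul_le_mul (by linarith) hsum (Finset.sum_nonneg fun i _ => by positivity)
            (by positivity)
      _ = _ := by ring
  · rw [le_div_iff₀ hLR]
    rcases Nat.lt_or_ge (i + 1) L with h | h
    · have h1 := card_levelSet_blockLevel_le (n := n) hrm h
      have h2 : (levelSet (blockLevel (r * m) L (n := n)) {i}).card * L ≤ 2 * n := by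
        have h2 := Nat.mul_le_mul_right L h1
        have h3 : r * m * L = r * L * m := by ring
        omega
      exact_mod_cast h2
    · have hiL : i + 1 = L := by omega
      have h1 := card_levelSet_blockLevel_top_le (n := n) hrm hiL
      have h2 : n - i * (r * m) ≤ r * m + r * L := by
        have : r * L * m = i * (r * m) + r * m := by rw [← hiL]; ring
        omega
      have h3 : (levelSet (blockLevel (r * m) L (n := n)) {i}).card * L ≤ 2 * n := by
        have h3 := Nat.mul_le_mul_right L (h1.trans h2)
        have h4 : (r * m + r * L) * L = r * L * m + r * L ^ 2 := by ring
        omega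
      exact_mod_cast h3
  · have hcast : ((L - 1 - i : ℕ) + 1 : ℝ) = L - i := by
      have : L - 1 - i + 1 + i = L := by omega
      have : ((L - 1 - i : ℕ) + 1 + i : ℝ) = L := by exact_mod_cast this
      linarith
    have hiL : (i : ℝ) ≤ L := by exact_mod_cast hi.le
    refine choose_sub_le hX ?_ ?_ ht
    · rw [hcast, div_le_one hLR]
      have : (0 : ℝ) ≤ i := Nat.cast_nonneg i
      linarith
    · rw [hcast]
      have h1 := Real.add_one_le_exp (-((L - i : ℝ) / L))
      have h2 : -((L - i : ℝ) / L) + 1 = i / L := by field_simp; ring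
      rw [h2] at h1
      refine le_trans ?_ (mul_le_mul_of_nonneg_left h1 hX.le)
      push_cast
      have : (m : ℝ) ≤ n / (r * L) := by
        rw [le_div_iff₀ (by positivity)]
        linarith
      calc (i * m : ℝ) ≤ i * (n / (r * L)) := by gcongr
        _ = _ := by field_simp
  · have : (1 / 2 : ℝ) ^ (L - 1 - i) ≤ 1 := pow_le_one₀ (by norm_num) (by norm_num)
    nlinarith

lemma logExp_nonneg (r : ℕ) : 0 ≤ logExp r := by
  rw [logExp]
  positivity

lemma logExp_sub_one_le {r : ℕ} (hr : 2 ≤ r) : logExp r - 1 ≤ -(1 / r) := by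
  rw [logExp]
  set a := ⌊Real.logb 2 (r : ℝ)⌋₊ with ha
  have hr0 : (0 : ℝ) < r := by
    have : 0 < r := by omega
    exact_mod_cast this
  have har : (a : ℝ) + 1 ≤ r := by
    have h1 : (a : ℝ) ≤ Real.logb 2 r := Nat.floor_le
      (Real.logb_nonneg (by norm_num) (by exact_mod_cast (by omega : 1 ≤ r)))
    rw [Real.le_logb_iff_rpow_le (by norm_num) hr0, Real.rpow_natCast] at h1
    have h2 : a + 1 ≤ 2 ^ a := Nat.lt_two_pow_self
    have h3 : ((a : ℝ) + 1) ≤ 2 ^ a := by exact_mod_cast h2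
    linarith
  have ha0 : (0 : ℝ) < a + 1 := by positivity
  have h4 : (a : ℝ) / (a + 1) - 1 = -(1 / (a + 1)) := by field_simp; ring
  rw [h4, neg_le_neg_iff]
  exact one_div_le_one_div_of_le ha0 har

section Asymptotics

variable {k r : ℕ}

lemma failure_bound_le (hr : 2 ≤ r) (hy : 100 * (r : ℝ) ^ 2 ≤ Real.log (Real.log k))
    (hk : 1 ≤ Real.log k) :
    (2 + 8 * r) * (2 * (32 * r ^ 3 * Real.exp (87 * r ^ 2) *
      ((3 / 16 : ℝ) * Real.exp (-(4 : ℝ) * (r : ℝ) ^ 2) * ((k : ℝ) / Real.log k) ^ logExp r *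
        ((r : ℝ) ^ k / (k : ℝ) ^ 2) * (k / r ^ k)))) ≤
      120 * Real.exp (-Real.log (Real.log k)) := by
  set y := Real.log (Real.log k) with hydef
  have hlogk : Real.log k = Real.exp y := (Real.exp_log (by linarith)).symm
  have hk0 : (0 : ℝ) < k := by
    rcases (Nat.cast_nonneg k : (0 : ℝ) ≤ k).eq_or_lt with h | h
    · rw [← h, Real.log_zero] at hk
      linarith
    · exact h
  have hr2 : (2 : ℝ) ≤ r := by exact_mod_cast hr
  have hr0 : (0 : ℝ) < r := by linarith
  have h1 : ((k : ℝ) / Real.log k) ^ logExp r / k ≤ Real.exp (-(Real.exp y / r)) := by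
    calc ((k : ℝ) / Real.log k) ^ logExp r / k ≤ (k : ℝ) ^ logExp r / k := by
          gcongr
          · exact logExp_nonneg r
          · exact div_le_self hk0.le hk
      _ = (k : ℝ) ^ (logExp r - 1) := (Real.rpow_sub_one hk0.ne' _).symm
      _ = Real.exp (Real.exp y * (logExp r - 1)) := by rw [Real.rpow_def_of_pos hk0, hlogk]
      _ ≤ _ := by
          refine Real.exp_le_exp.2 ?_
          have := mul_le_mul_of_nonneg_left (logExp_sub_one_le hr) (Real.exp_pos y).le
          rw [← hlogk] at this ⊢
          calc _ ≤ _ := this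
            _ = _ := by ring
  have hy0 : 0 < y := by nlinarith
  have h2 : 86 * (r : ℝ) ^ 2 - Real.exp y / r ≤ -y := by
    have h3 : y ^ 2 / 2 ≤ Real.exp y := by
      have := Real.pow_div_factorial_le_exp y hy0.le 2
      simpa using this
    have h4 : 2 * y ≤ Real.exp y / r := by
      rw [le_div_iff₀ hr0]
      nlinarith
    linarith
  have hr4 : (r : ℝ) ^ 4 ≤ Real.exp (2 * (r : ℝ) ^ 2) := by
    have h5 : (r : ℝ) ^ 2 ≤ Real.exp ((r : ℝ) ^ 2) := by
      linarith [Real.add_one_le_exp ((r : ℝ) ^ 2)]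
    have h6 : Real.exp (2 * (r : ℝ) ^ 2) = Real.exp ((r : ℝ) ^ 2) * Real.exp ((r : ℝ) ^ 2) := by
      rw [← Real.exp_add]; ring_nf
    rw [h6]
    nlinarith [sq_nonneg (r : ℝ)]
  have hrk : (r : ℝ) ^ k ≠ 0 := by positivity
  calc _ = 12 * (2 + 8 * r) * r ^ 3 * (Real.exp (87 * r ^ 2) * Real.exp (-4 * (r : ℝ) ^ 2)) *
        (((k : ℝ) / Real.log k) ^ logExp r / k) := by
        generalize ((k : ℝ) / Real.log k) ^ logExp r = A
        field_simp
        ring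
    _ ≤ 120 * Real.exp (2 * (r : ℝ) ^ 2) *
        (Real.exp (87 * r ^ 2) * Real.exp (-4 * (r : ℝ) ^ 2)) *
        Real.exp (-(Real.exp y / r)) := by
        have h7 : 12 * (2 + 8 * (r : ℝ)) * r ^ 3 ≤ 120 * Real.exp (2 * (r : ℝ) ^ 2) := by
          refine le_trans ?_ (mul_le_mul_of_nonneg_left hr4 (by norm_num))
          have : (0 : ℝ) < r ^ 3 := by positivity
          nlinarith
        gcongr
    _ = 120 * Real.exp (85 * (r : ℝ) ^ 2 - Real.exp y / r) := by
        rw [mul_assoc, mul_assoc, ← Real.exp_add, ← Real.exp_add, ← Real.exp_add]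
        ring_nf
    _ ≤ _ := by
        gcongr
        nlinarith [sq_nonneg (r : ℝ)]

lemma le_of_expected_edges_le_log {n : ℕ} (hr : 2 ≤ r) (hn : 1 ≤ n)
    (hy : 100 * (r : ℝ) ^ 2 ≤ Real.log (Real.log k)) (hk : 1 ≤ Real.log k)
    (hD : (3 / 16 : ℝ) * Real.exp (-(4 : ℝ) * (r : ℝ) ^ 2) * ((k : ℝ) / Real.log k) ^ logExp r *
        ((r : ℝ) ^ k / (k : ℝ)) ≤ Real.log n) :
    8 * r ≤ k ∧ 2 * r ^ 2 * k ^ 2 ≤ n := by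
  set y := Real.log (Real.log k) with hydef
  have hlogk : Real.log k = Real.exp y := (Real.exp_log (by linarith)).symm
  have hk0 : (0 : ℝ) < k := by
    rcases (Nat.cast_nonneg k : (0 : ℝ) ≤ k).eq_or_lt with h | h
    · rw [← h, Real.log_zero] at hk
      linarith
    · exact h
  have hr2 : (2 : ℝ) ≤ r := by exact_mod_cast hr
  have hlk : Real.log k ≤ k := by linarith [Real.log_le_sub_one_of_pos hk0]
  have hy400 : 400 ≤ y := by nlinarith
  have hylog : y ^ 2 / 2 ≤ Real.log k := by
    rw [hlogk]
    have := Real.pow_div_factorial_le_exp y (by linarith) 2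
    simpa using this
  have hkbig : 80000 ≤ (k : ℝ) := by nlinarith
  have hrk : 100 * (r : ℝ) ^ 2 ≤ k := by nlinarith
  refine ⟨?_, ?_⟩
  · have : 8 * (r : ℝ) ≤ k := by nlinarith
    exact_mod_cast this
  have hpow : 22 * (k : ℝ) ^ 3 ≤ (r : ℝ) ^ k := by
    have h1 : (2 : ℝ) ^ k ≤ (r : ℝ) ^ k := pow_le_pow_left₀ (by norm_num) hr2 k
    refine le_trans ?_ h1
    have h2 : (2 : ℝ) ^ k = Real.exp (k * Real.log 2) := by
      rw [Real.exp_nat_mul, Real.exp_log (by norm_num)]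
    have h3 := Real.pow_div_factorial_le_exp (k * Real.log 2)
      (mul_nonneg hk0.le (Real.log_nonneg (by norm_num))) 4
    have hl2 := Real.log_two_gt_d9
    have h4 : (1 / 2 * k : ℝ) ^ 4 ≤ (k * Real.log 2) ^ 4 := by
      refine pow_le_pow_left₀ (by positivity) ?_ 4
      nlinarith
    norm_num [Nat.factorial] at h3
    rw [h2]
    have : (0 : ℝ) < (k : ℝ) ^ 3 := by positivity
    nlinarith
  have hbase : 1 ≤ ((k : ℝ) / Real.log k) ^ logExp r :=
    Real.one_le_rpow ((one_le_div (by linarith)).2 hlk) (logExp_nonneg r)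
  have hexp : 1 / Real.log k ≤ Real.exp (-(4 : ℝ) * (r : ℝ) ^ 2) := by
    rw [hlogk, one_div, ← Real.exp_neg]
    refine Real.exp_le_exp.2 ?_
    nlinarith [sq_nonneg (r : ℝ)]
  have hL0 : 0 < Real.log k := by linarith
  have hlow : 4 * Real.log k ≤ Real.log n := by
    refine le_trans ?_ hD
    calc 4 * Real.log k ≤ (3 / 16 : ℝ) * (1 / Real.log k) * 1 * (22 * (k : ℝ) ^ 3 / k) := by
          have : (3 / 16 : ℝ) * (1 / Real.log k) * 1 * (22 * (k : ℝ) ^ 3 / k) =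
              33 / 8 * (k : ℝ) ^ 2 / Real.log k := by
            field_simp
            ring
          rw [this, le_div_iff₀ hL0]
          nlinarith
      _ ≤ _ := by gcongr
  have hnR : (0 : ℝ) < n := by exact_mod_cast hn
  have h4 : (k : ℝ) ^ 4 ≤ n := by
    rw [← Real.log_le_log_iff (by positivity) hnR, Real.log_pow]
    exact_mod_cast hlow
  have h5 : 2 * (r : ℝ) ^ 2 * k ^ 2 ≤ n := by
    refine le_trans ?_ h4
    have : 2 * (r : ℝ) ^ 2 ≤ (k : ℝ) ^ 2 := by nlinarith
    nlinarith [sq_nonneg (k : ℝ)]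
  exact_mod_cast h5

end Asymptotics

end HG

/-- Suppose `k = k(n) ≥ 3` and `r = r(n) ≥ 2` satisfy
`r = o(√(ln ln k))` and
`(3/16) e^(−4r²) (k/ln k)^(⌊log₂ r⌋/(⌊log₂ r⌋+1)) r^k/k − ln n → −∞`. If
`p = p(n) ≤ (3/16) e^(−4r²) (k/ln k)^(⌊log₂ r⌋/(⌊log₂ r⌋+1)) (r^k/k²) n / C(n,k)`,
then `P(H(n,k,p) is r-colorable) → 1` as `n → ∞`. -/
theorem stmt4 (k r : ℕ → ℕ) (p : ℕ → ℝ)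
    (hk : ∀ n, 3 ≤ k n) (hr : ∀ n, 2 ≤ r n)
    (hro : (fun n => (r n : ℝ)) =o[atTop]
      fun n => Real.sqrt (Real.log (Real.log (k n))))
    (hd : Tendsto
      (fun n => (3 / 16 : ℝ) * Real.exp (-(4 : ℝ) * (r n : ℝ) ^ 2) *
        ((k n : ℝ) / Real.log (k n)) ^ logExp (r n) *
        ((r n : ℝ) ^ (k n) / (k n : ℝ)) - Real.log n) atTop atBot)
    (hp0 : ∀ n, 0 ≤ p n)
    (hp : ∀ n, p n ≤ (3 / 16 : ℝ) * Real.exp (-(4 : ℝ) * (r n : ℝ) ^ 2) *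
        ((k n : ℝ) / Real.log (k n)) ^ logExp (r n) *
        ((r n : ℝ) ^ (k n) / (k n : ℝ) ^ 2) *
        ((n : ℝ) / (n.choose (k n) : ℝ))) :
    Tendsto (fun n => HG.hyperProb n (k n) (p n) (HG.RColorable (r n)))
      atTop (nhds 1) := by
  have hlog1 : ∀ n, 1 ≤ Real.log (k n) := fun n => by
    have h3 : (3 : ℝ) ≤ k n := by exact_mod_cast hk n
    rw [Real.le_log_iff_exp_le (by linarith)]
    linarith [Real.exp_one_lt_d9]
  set y : ℕ → ℝ := fun n => Real.log (Real.log (k n)) with hydef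
  have hy0 : ∀ n, 0 ≤ y n := fun n => Real.log_nonneg (hlog1 n)
  have hysq : ∀ᶠ n in atTop, 100 * (r n : ℝ) ^ 2 ≤ y n := by
    filter_upwards [hro.bound (show (0 : ℝ) < 1 / 10 by norm_num)] with n hn
    rw [Real.norm_of_nonneg (Nat.cast_nonneg _), Real.norm_of_nonneg (Real.sqrt_nonneg _)] at hn
    have h1 := Real.sq_sqrt (hy0 n)
    have h2 : (0 : ℝ) ≤ r n := Nat.cast_nonneg _
    change (r n : ℝ) ≤ 1 / 10 * √(y n) at hn
    nlinarith
  have hytop : Tendsto y atTop atTop := by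
    have h1 : (fun _ : ℕ => (2 : ℝ)) =o[atTop] fun n => √(y n) := by
      refine Asymptotics.IsBigO.trans_isLittleO (Asymptotics.IsBigO.of_bound 1 ?_) hro
      refine Eventually.of_forall fun n => ?_
      rw [Real.norm_of_nonneg (Nat.cast_nonneg _), one_mul]
      simpa using hr n
    rw [Asymptotics.isLittleO_const_left_of_ne (by norm_num)] at h1
    refine tendsto_atTop_mono' atTop ?_ h1
    filter_upwards [hysq] with n hn
    have h2 : (2 : ℝ) ≤ r n := by exact_mod_cast hr n
    rw [Real.norm_of_nonneg (Real.sqrt_nonneg _), Real.sqrt_le_left (hy0 n)]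
    have h3 : 400 ≤ y n := by nlinarith
    nlinarith
  have hzero : Tendsto (fun n => 1 - 120 * Real.exp (-y n)) atTop (nhds 1) := by
    have h1 : Tendsto (fun n => Real.exp (-y n)) atTop (nhds 0) :=
      Real.tendsto_exp_neg_atTop_nhds_zero.comp hytop
    simpa using (h1.const_mul 120).const_sub 1
  have hmain : ∀ᶠ n in atTop,
      1 - 120 * Real.exp (-y n) ≤ HG.hyperProb n (k n) (p n) (HG.RColorable (r n)) ∧
        HG.hyperProb n (k n) (p n) (HG.RColorable (r n)) ≤ 1 := by
    filter_upwards [hysq, hd.eventually_le_atBot 0, eventually_ge_atTop 1] with n hyn hdn hn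
    have hk0 : (0 : ℝ) < k n := by
      have := hk n
      exact_mod_cast (by omega : 0 < k n)
    have hL0 : 0 < Real.log (k n) := by linarith [hlog1 n]
    obtain ⟨h8, hbig⟩ := HG.le_of_expected_edges_le_log (hr n) hn hyn (hlog1 n) (by linarith)
    have hfail := HG.failure_bound_le (hr n) hyn (hlog1 n)
    have hc : (0 : ℝ) ≤ (3 / 16 : ℝ) * Real.exp (-(4 : ℝ) * (r n : ℝ) ^ 2) *
        ((k n : ℝ) / Real.log (k n)) ^ logExp (r n) * ((r n : ℝ) ^ (k n) / (k n : ℝ) ^ 2) := by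
      positivity
    have hr2 : (2 : ℝ) ≤ r n := by exact_mod_cast hr n
    have hexp : 240 * Real.exp (-y n) ≤ 1 := by
      rw [Real.exp_neg, ← div_eq_mul_inv, div_le_one (Real.exp_pos _)]
      have := Real.add_one_le_exp (y n)
      nlinarith
    have hres := HG.one_sub_hyperProb_rColorable_le_and_le_one (hr n) h8 hbig hc (hp0 n) (hp n) ?_
    · refine ⟨?_, hres.2⟩
      have := hres.1.trans hfail
      linarith
    · change _ ≤ 120 * Real.exp (-y n) at hfail
      refine le_trans ?_ (hfail.trans (by linarith))
      set Λ : ℝ := 32 * (r n : ℝ) ^ 3 * Real.exp (87 * (r n : ℝ) ^ 2) *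
        ((3 / 16 : ℝ) * Real.exp (-(4 : ℝ) * (r n : ℝ) ^ 2) *
          ((k n : ℝ) / Real.log (k n)) ^ logExp (r n) * ((r n : ℝ) ^ (k n) / (k n : ℝ) ^ 2) *
            (k n / (r n : ℝ) ^ (k n))) with hΛ
      have hΛ0 : 0 ≤ Λ := by positivity
      nlinarith
  refine tendsto_of_tendsto_of_tendsto_of_le_of_le' hzero tendsto_const_nhds ?_ ?_
  · filter_upwards [hmain] with n hn using hn.1
  · filter_upwards [hmain] with n hn using hn.2
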